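/- arXiv:1412.4978 — 3 statements merged into one kernel-verified Lean document; each statement's English description precedes it below -/
import Mathlib

section
/- Let 𝒞 be the bicyclic inverse semigroup and let X be a commutative Banach ℓ¹(𝒞)-ℓ¹(E_𝒞)-bimodule whose left ℓ¹(E_𝒞)-action is trivial via the augmentation character and which is an 𝓛₁-space. Then for every k ∈ ℕ, the k-th module cohomology H^k_{ℓ¹(E_𝒞)}(ℓ¹(𝒞), X*) = 0. -/
noncomputable section

/-- merged sequence -/
def mergeAt {A : Type*} [Mul A] {n : ℕ} (u : Fin (n + 1) → A) (j : Fin n) : Fin n → A :=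
  fun i =>
    if i.val < j.val then u i.castSucc
    else if i = j then u j.castSucc * u j.succ
    else u i.succ

variable {A W : Type*}
  [NonUnitalNormedRing A] [NormedSpace ℂ A]
  [NormedAddCommGroup W] [NormedSpace ℂ W]

/-- The space of bounded `n`-linear maps from `A × ⋯ × A` to `W` (Hochschild `n`-cochains). -/
abbrev Cochain (A W : Type*) [NonUnitalNormedRing A] [NormedSpace ℂ A]
    [NormedAddCommGroup W] [NormedSpace ℂ W] (n : ℕ) : Type _ :=
  ContinuousMultilinearMap ℂ (fun _ : Fin n => A) W

/-- The Hochschild coboundary of an `n`-cochain, w.r.t. the actions `lW`, `rW` of `A` on `W`. -/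
def hDelta (lW : A →L[ℂ] W →L[ℂ] W) (rW : W →L[ℂ] A →L[ℂ] W) (n : ℕ)
    (T : Cochain A W n) : (Fin (n + 1) → A) → W :=
  fun v =>
    lW (v 0) (T (Fin.tail v)) +
      (∑ i : Fin n, ((-1 : ℂ) ^ (i.val + 1)) • T (mergeAt v i)) +
      ((-1 : ℂ) ^ (n + 1)) • rW (T (Fin.init v)) (v (Fin.last n))

theorem hDelta_add (lW : A →L[ℂ] W →L[ℂ] W) (rW : W →L[ℂ] A →L[ℂ] W) (n : ℕ)
    (T S : Cochain A W n) (v : Fin (n + 1) → A) :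
    hDelta lW rW n (T + S) v = hDelta lW rW n T v + hDelta lW rW n S v := by
  simp only [hDelta, ContinuousMultilinearMap.add_apply, map_add,
    ContinuousLinearMap.add_apply, smul_add, Finset.sum_add_distrib]
  abel

theorem hDelta_smul (lW : A →L[ℂ] W →L[ℂ] W) (rW : W →L[ℂ] A →L[ℂ] W) (n : ℕ)
    (c : ℂ) (T : Cochain A W n) (v : Fin (n + 1) → A) :
    hDelta lW rW n (c • T) v = c • hDelta lW rW n T v := by
  simp only [hDelta, ContinuousMultilinearMap.smul_apply, map_smul,
    ContinuousLinearMap.smul_apply]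
  rw [smul_add, smul_add, Finset.smul_sum]
  congr 1
  · congr 1
    exact Finset.sum_congr rfl fun i _ => smul_comm ((-1 : ℂ) ^ (i.val + 1)) c _
  · exact smul_comm ((-1 : ℂ) ^ (n + 1)) c _

theorem hDelta_zero (lW : A →L[ℂ] W →L[ℂ] W) (rW : W →L[ℂ] A →L[ℂ] W) (n : ℕ)
    (v : Fin (n + 1) → A) : hDelta lW rW n (0 : Cochain A W n) v = 0 := by
  simp [hDelta]

variable (lW : A →L[ℂ] W →L[ℂ] W) (rW : W →L[ℂ] A →L[ℂ] W)
  (M : ∀ n : ℕ, Submodule ℂ (Cochain A W n))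

/-- The space of `n`-cocycles lying in the admissible class `M` (e.g. `𝔄`-module cochains). -/
def cocycles (n : ℕ) : Submodule ℂ (Cochain A W n) where
  carrier := {T | T ∈ M n ∧ ∀ v, hDelta lW rW n T v = 0}
  add_mem' := by
    rintro T S ⟨hT1, hT2⟩ ⟨hS1, hS2⟩
    exact ⟨(M n).add_mem hT1 hS1, fun v => by rw [hDelta_add, hT2 v, hS2 v, add_zero]⟩
  zero_mem' := ⟨(M n).zero_mem, fun v => hDelta_zero lW rW n v⟩
  smul_mem' := by
    rintro c T ⟨hT1, hT2⟩
    exact ⟨(M n).smul_mem c hT1, fun v => by rw [hDelta_smul, hT2 v, smul_zero]⟩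

/-- The space of `(n+1)`-coboundaries of admissible `n`-cochains. -/
def coboundaries (n : ℕ) : Submodule ℂ (Cochain A W (n + 1)) where
  carrier := {T | ∃ S, S ∈ M n ∧ ∀ v, T v = hDelta lW rW n S v}
  add_mem' := by
    rintro T T' ⟨S, hS, hTS⟩ ⟨S', hS', hTS'⟩
    exact ⟨S + S', (M n).add_mem hS hS', fun v => by
      rw [ContinuousMultilinearMap.add_apply, hTS v, hTS' v, hDelta_add]⟩
  zero_mem' := ⟨0, (M n).zero_mem, fun v => by
    rw [ContinuousMultilinearMap.zero_apply, hDelta_zero]⟩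
  smul_mem' := by
    rintro c T ⟨S, hS, hTS⟩
    exact ⟨c • S, (M n).smul_mem c hS, fun v => by
      rw [ContinuousMultilinearMap.smul_apply, hTS v, hDelta_smul]⟩

/-- The `(n+1)`-st cohomology space (of the complex of admissible cochains):
cocycles modulo coboundaries. -/
def cohomology (n : ℕ) :=
  ↥(cocycles lW rW M (n + 1)) ⧸
    (coboundaries lW rW M n).comap (cocycles lW rW M (n + 1)).subtype

instance (n : ℕ) : AddCommGroup (cohomology lW rW M n) :=
  Submodule.Quotient.addCommGroup _

instance (n : ℕ) : Module ℂ (cohomology lW rW M n) := Submodule.Quotient.module _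

/-- The quotient seminorm on the cohomology space. -/
def cohomSeminorm (n : ℕ) (c : cohomology lW rW M n) : ℝ :=
  ⨅ T : {T : ↥(cocycles lW rW M (n + 1)) // Submodule.Quotient.mk T = c},
    ‖((T : ↥(cocycles lW rW M (n + 1))) : Cochain A W (n + 1))‖

/-- The admissible class of `𝔄`-module cochains, for the right `𝔄`-action `ρ` on `A` and
the trivial (commutative) `𝔄`-action on the coefficients via the character `f`. -/
def moduleCochains {𝔄 : Type*} [NonUnitalNormedRing 𝔄] [NormedSpace ℂ 𝔄]
    (f : 𝔄 →L[ℂ] ℂ) (ρ : A →L[ℂ] 𝔄 →L[ℂ] A) (n : ℕ) : Submodule ℂ (Cochain A W n) where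
  carrier := {T | ∀ (v : Fin n → A) (i : Fin n) (α : 𝔄),
    T (Function.update v i (ρ (v i) α)) = f α • T v}
  add_mem' := by
    intro T S hT hS v i α
    simp only [ContinuousMultilinearMap.add_apply, hT v i α, hS v i α, smul_add]
  zero_mem' := by simp
  smul_mem' := by
    intro c T hT v i α
    simp only [ContinuousMultilinearMap.smul_apply, hT v i α]
    rw [smul_comm]

/-- A closed two-sided ideal of a (not necessarily unital) Banach algebra. -/
def IsClosedIdeal {A : Type*} [NonUnitalNormedRing A] [NormedSpace ℂ A]
    (J : Submodule ℂ A) : Prop :=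
  IsClosed (J : Set A) ∧ (∀ a x : A, x ∈ J → a * x ∈ J) ∧ ∀ x a : A, x ∈ J → x * a ∈ J

/-- `J` is the smallest closed two-sided ideal containing the set `S`. -/
def IsClosedIdealGeneratedBy {A : Type*} [NonUnitalNormedRing A] [NormedSpace ℂ A]
    (J : Submodule ℂ A) (S : Set A) : Prop :=
  IsClosedIdeal J ∧ S ⊆ (J : Set A) ∧
    ∀ K : Submodule ℂ A, IsClosedIdeal K → S ⊆ (K : Set A) → J ≤ K

/-- `S` is an inverse semigroup with inversion `star`: each element `s` has `star s` as its
unique generalized inverse. -/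
def IsInverseSemigroup (S : Type*) [Semigroup S] (star : S → S) : Prop :=
  (∀ s, s * star s * s = s) ∧ (∀ s, star s * s * star s = star s) ∧
    ∀ s t, s * t * s = s → t * s * t = t → t = star s

/-- `(L, δ)` is (a realization of) the semigroup Banach algebra `ℓ¹(S)` of a discrete
semigroup `S`: `δ` is the family of point masses, which is multiplicative, the norm of a
finitely supported combination is its `ℓ¹`-norm, and the span of the point masses is
dense. -/
def IsL1SemigroupAlgebra (S : Type*) [Semigroup S] (L : Type*)
    [NonUnitalNormedRing L] [NormedSpace ℂ L] [CompleteSpace L] (δ : S → L) : Prop :=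
  (∀ s t, δ s * δ t = δ (s * t)) ∧
  (∀ (F : Finset S) (c : S → ℂ), ‖∑ s ∈ F, c s • δ s‖ = ∑ s ∈ F, ‖c s‖) ∧
  Function.Injective δ ∧
  Dense ((Submodule.span ℂ (Set.range δ) : Submodule ℂ L) : Set L)

/-- `X` is an `𝓛₁`-space. -/
def IsL1Space (X : Type*) [NormedAddCommGroup X] [NormedSpace ℂ X] : Prop :=
  ∃ lam : ℝ, 1 < lam ∧ ∀ M : Submodule ℂ X, FiniteDimensional ℂ M →
    ∃ N : Submodule ℂ X, FiniteDimensional ℂ N ∧ M ≤ N ∧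
      ∃ T : N ≃L[ℂ] PiLp 1 (fun _ : Fin (Module.finrank ℂ N) => ℂ),
        ‖(T : N →L[ℂ] PiLp 1 (fun _ : Fin (Module.finrank ℂ N) => ℂ))‖ *
          ‖(T.symm : PiLp 1 (fun _ : Fin (Module.finrank ℂ N) => ℂ) →L[ℂ] N)‖ ≤ lam

/-- A Banach limit, extended linearly to all sequences. -/
theorem exists_banachLimit : ∃ Λ : (ℕ → ℂ) →ₗ[ℂ] ℂ,
    (∀ (u : ℕ → ℂ) (K : ℝ), (∀ n, ‖u n‖ ≤ K) → ‖Λ u‖ ≤ K) ∧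
    (∀ (u : ℕ → ℂ) (K : ℝ), (∀ n, ‖u n‖ ≤ K) → Λ (fun n => u (n + 1)) = Λ u) ∧
    (∀ c : ℂ, Λ (fun _ => c) = c) := by
  let U : Filter ℕ := (Filter.hyperfilter ℕ : Filter ℕ)
  have hU : U ≤ Filter.atTop := Nat.hyperfilter_le_atTop
  let av : (ℕ → ℂ) → ℕ → ℂ := fun u N => ((N : ℂ) + 1)⁻¹ * ∑ n ∈ Finset.range (N + 1), u n
  have hnorm : ∀ N : ℕ, ‖((N : ℂ) + 1)‖ = (N : ℝ) + 1 := by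
    intro N
    have : ((N : ℂ) + 1) = ((N + 1 : ℕ) : ℂ) := by push_cast; rfl
    rw [this, Complex.norm_natCast]; push_cast; rfl
  have hav : ∀ (u : ℕ → ℂ) (K : ℝ), (∀ n, ‖u n‖ ≤ K) → ∀ N, ‖av u N‖ ≤ K := by
    intro u K hu N
    have hpos : (0 : ℝ) < (N : ℝ) + 1 := by positivity
    have h1 : ‖∑ n ∈ Finset.range (N + 1), u n‖ ≤ ((N : ℝ) + 1) * K := by
      refine (norm_sum_le_of_le _ (fun n _ => hu n)).trans ?_
      simp
    simp only [av]
    rw [norm_mul, norm_inv, hnorm]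
    calc ((N : ℝ) + 1)⁻¹ * ‖∑ n ∈ Finset.range (N + 1), u n‖
        ≤ ((N : ℝ) + 1)⁻¹ * (((N : ℝ) + 1) * K) := by gcongr
      _ = K := by field_simp
  have hlim : ∀ (u : ℕ → ℂ) (K : ℝ), (∀ n, ‖u n‖ ≤ K) →
      ∃ l, Filter.Tendsto (av u) U (nhds l) := by
    intro u K hu
    have hc : IsCompact (Metric.closedBall (0 : ℂ) K) := isCompact_closedBall _ _
    obtain ⟨l, -, hl⟩ := hc.ultrafilter_le_nhds ((Filter.hyperfilter ℕ).map (av u)) (by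
      rw [Filter.le_principal_iff]
      exact Filter.mem_map.2 (Filter.univ_mem' fun N => by
        simpa using hav u K hu N))
    exact ⟨l, hl⟩
  let B : Submodule ℂ (ℕ → ℂ) :=
    { carrier := {u | ∃ K : ℝ, ∀ n, ‖u n‖ ≤ K}
      add_mem' := by
        rintro u v ⟨K, hK⟩ ⟨K', hK'⟩
        exact ⟨K + K', fun n => norm_add_le_of_le (hK n) (hK' n)⟩
      zero_mem' := ⟨0, by simp⟩
      smul_mem' := by
        rintro c u ⟨K, hK⟩
        exact ⟨‖c‖ * K, fun n => by
          simp only [Pi.smul_apply, norm_smul]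
          exact mul_le_mul_of_nonneg_left (hK n) (norm_nonneg _)⟩ }
  have hB : ∀ u : B, ∃ l, Filter.Tendsto (av u.1) U (nhds l) := by
    rintro ⟨u, K, hK⟩
    exact hlim u K hK
  choose l hl using hB
  have hav_add : ∀ u v, av (u + v) = fun N => av u N + av v N := by
    intro u v; funext N
    simp only [av, Pi.add_apply, Finset.sum_add_distrib, mul_add]
  have hav_smul : ∀ (c : ℂ) u, av (c • u) = fun N => c * av u N := by
    intro c u; funext N
    simp only [av, Pi.smul_apply, smul_eq_mul, ← Finset.mul_sum]
    ring
  let Λ0 : B →ₗ[ℂ] ℂ :=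
    { toFun := l
      map_add' := fun u v => by
        refine tendsto_nhds_unique (hl (u + v)) ?_
        have := (hl u).add (hl v)
        rw [Submodule.coe_add, hav_add]; exact this
      map_smul' := fun c u => by
        refine tendsto_nhds_unique (hl (c • u)) ?_
        have := (hl u).const_mul c
        rw [Submodule.coe_smul, hav_smul]; exact this }
  obtain ⟨Λ, hΛ⟩ := Λ0.exists_extend
  have hΛl : ∀ u (hu : u ∈ B), Filter.Tendsto (av u) U (nhds (Λ u)) := by
    intro u hu
    have h : Λ u = l ⟨u, hu⟩ := by
      have := LinearMap.congr_fun hΛ ⟨u, hu⟩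
      exact this
    rw [h]
    exact hl ⟨u, hu⟩
  refine ⟨Λ, ?_, ?_, ?_⟩
  · intro u K hu
    exact le_of_tendsto (hΛl u ⟨K, hu⟩).norm (Filter.Eventually.of_forall (hav u K hu))
  · intro u K hu
    have h1 := hΛl u ⟨K, hu⟩
    have h2 := hΛl (fun n => u (n + 1)) ⟨K, fun n => hu (n + 1)⟩
    have h3 : Filter.Tendsto (fun N => av (fun n => u (n + 1)) N - av u N) U (nhds 0) := by
      refine Filter.Tendsto.mono_left ?_ hU
      have h4 : ∀ N : ℕ, ‖av (fun n => u (n + 1)) N - av u N‖ ≤ (2 * K) * (1 / ((N : ℝ) + 1)) := by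
        intro N
        have : av (fun n => u (n + 1)) N - av u N = ((N : ℂ) + 1)⁻¹ * (u (N + 1) - u 0) := by
          simp only [av]
          rw [← mul_sub, ← Finset.sum_sub_distrib, Finset.sum_range_sub]
        rw [this, norm_mul, norm_inv, hnorm, mul_comm, one_div]
        have : ‖u (N + 1) - u 0‖ ≤ 2 * K := by
          refine (norm_sub_le _ _).trans ?_
          linarith [hu (N + 1), hu 0]
        gcongr
      refine squeeze_zero_norm h4 ?_
      simpa using (tendsto_one_div_add_atTop_nhds_zero_nat (𝕜 := ℝ)).const_mul (2 * K)
    have h5 := tendsto_nhds_unique (h2.sub h1) h3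
    exact sub_eq_zero.1 h5
  · intro c
    refine tendsto_nhds_unique (hΛl (fun _ => c) ⟨‖c‖, fun _ => le_rfl⟩) ?_
    have : av (fun _ => c) = fun _ => c := by
      funext N
      have hne : ((N : ℂ) + 1) ≠ 0 := Nat.cast_add_one_ne_zero N
      simp only [av, Finset.sum_const, Finset.card_range, nsmul_eq_mul]
      push_cast
      field_simp
    rw [this]
    exact tendsto_const_nhds

theorem mergeAt_cons_zero {A : Type*} [Mul A] {n : ℕ} (a : A) (v : Fin (n + 1) → A) :
    mergeAt (Fin.cons a v : Fin (n + 2) → A) 0 = Fin.cons (a * v 0) (Fin.tail v) := by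
  funext i
  refine Fin.cases ?_ (fun i => ?_) i
  · simp [mergeAt]
  · simp [mergeAt, Fin.tail, Fin.succ_ne_zero]

theorem mergeAt_cons_succ {A : Type*} [Mul A] {n : ℕ} (a : A) (v : Fin (n + 1) → A)
    (j : Fin n) :
    mergeAt (Fin.cons a v : Fin (n + 2) → A) j.succ = Fin.cons a (mergeAt v j) := by
  funext i
  refine Fin.cases ?_ (fun i => ?_) i
  · simp [mergeAt]
  · simp [mergeAt, Fin.castSucc_succ]

theorem init_cons' {A : Type*} {n : ℕ} (a : A) (v : Fin (n + 1) → A) :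
    Fin.init (Fin.cons a v : Fin (n + 2) → A) = (Fin.cons a (Fin.init v) : Fin (n + 1) → A) := by
  funext i
  refine Fin.cases ?_ (fun i => ?_) i
  · simp [Fin.init]
  · simp [Fin.init, Fin.castSucc_succ]

theorem hDelta_cons (lW : A →L[ℂ] W →L[ℂ] W) (rW : W →L[ℂ] A →L[ℂ] W) (n : ℕ)
    (T : Cochain A W (n + 1)) (a : A) (v : Fin (n + 1) → A) :
    hDelta lW rW (n + 1) T (Fin.cons a v) =
      lW a (T v) - T (Fin.cons (a * v 0) (Fin.tail v)) + lW (v 0) (T (Fin.cons a (Fin.tail v)))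
        - hDelta lW rW n (T.curryLeft a) v := by
  have hlast : (Fin.cons a v : Fin (n + 2) → A) (Fin.last (n + 1)) = v (Fin.last n) := by
    rw [← Fin.succ_last, Fin.cons_succ]
  simp only [hDelta, Fin.sum_univ_succ, mergeAt_cons_zero, mergeAt_cons_succ, init_cons', hlast,
    Fin.cons_zero, Fin.tail_cons, ContinuousMultilinearMap.curryLeft_apply, Fin.val_zero,
    Fin.val_succ]
  have : ∀ x : Fin n, (-1 : ℂ) ^ (x.val + 1 + 1) • T (Fin.cons a (mergeAt v x)) =
      - ((-1 : ℂ) ^ (x.val + 1) • T (Fin.cons a (mergeAt v x))) := by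
    intro x; rw [pow_succ _ (x.val + 1)]; simp
  rw [Finset.sum_congr rfl (fun x _ => this x), Finset.sum_neg_distrib,
    pow_succ _ (n + 1)]
  simp
  abel

/-- Pushing a family of cochains through a bounded functional on sequences. -/
theorem exists_limit_cochain {X : Type*} [NormedAddCommGroup X] [NormedSpace ℂ X]
    (Λ : (ℕ → ℂ) →ₗ[ℂ] ℂ)
    (hΛ : ∀ (u : ℕ → ℂ) (K : ℝ), (∀ n, ‖u n‖ ≤ K) → ‖Λ u‖ ≤ K) (n : ℕ)
    (F : ℕ → Cochain A (X →L[ℂ] ℂ) n) (K : ℝ) (hF : ∀ j, ‖F j‖ ≤ K) :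
    ∃ S : Cochain A (X →L[ℂ] ℂ) n, ∀ v x, S v x = Λ (fun j => F j v x) := by
  have hb : ∀ v x j, ‖F j v x‖ ≤ (K * ∏ i, ‖v i‖) * ‖x‖ := by
    intro v x j
    refine (ContinuousLinearMap.le_opNorm _ _).trans ?_
    gcongr
    refine (ContinuousMultilinearMap.le_opNorm _ _).trans ?_
    gcongr
    exact hF j
  have hK : 0 ≤ K := (norm_nonneg _).trans (hF 0)
  let s : (Fin n → A) → (X →L[ℂ] ℂ) := fun v =>
    LinearMap.mkContinuous
      { toFun := fun x => Λ (fun j => F j v x)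
        map_add' := fun x y => by
          rw [← map_add]; congr 1; funext j; simp
        map_smul' := fun c x => by
          rw [RingHom.id_apply, ← map_smul]; congr 1; funext j; simp }
      (K * ∏ i, ‖v i‖) (fun x => hΛ _ _ (hb v x))
  have hs : ∀ v x, s v x = Λ (fun j => F j v x) := fun v x => rfl
  let m : MultilinearMap ℂ (fun _ : Fin n => A) (X →L[ℂ] ℂ) :=
    { toFun := s
      map_update_add' := fun v i a b => by
        ext x
        rw [ContinuousLinearMap.add_apply, hs, hs, hs, ← map_add]
        congr 1; funext j; simp
      map_update_smul' := fun v i c a => by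
        ext x
        rw [ContinuousLinearMap.smul_apply, hs, hs, ← map_smul]
        congr 1; funext j; simp }
  refine ⟨m.mkContinuous K (fun v => ?_), fun v x => rfl⟩
  exact ContinuousLinearMap.opNorm_le_bound _ (by positivity) (fun x => hΛ _ _ (hb v x))

theorem hDelta_limit {X : Type*} [NormedAddCommGroup X] [NormedSpace ℂ X]
    (lX : A →L[ℂ] X →L[ℂ] X) (rX : X →L[ℂ] A →L[ℂ] X)
    (lXd : A →L[ℂ] (X →L[ℂ] ℂ) →L[ℂ] (X →L[ℂ] ℂ))
    (rXd : (X →L[ℂ] ℂ) →L[ℂ] A →L[ℂ] (X →L[ℂ] ℂ))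
    (hlXd : ∀ (a : A) (φ : X →L[ℂ] ℂ) (x : X), lXd a φ x = φ (rX x a))
    (hrXd : ∀ (φ : X →L[ℂ] ℂ) (a : A) (x : X), rXd φ a x = φ (lX a x))
    (Λ : (ℕ → ℂ) →ₗ[ℂ] ℂ) (n : ℕ)
    (F : ℕ → Cochain A (X →L[ℂ] ℂ) n) (S : Cochain A (X →L[ℂ] ℂ) n)
    (hS : ∀ v x, S v x = Λ (fun j => F j v x)) (v : Fin (n + 1) → A) (x : X) :
    hDelta lXd rXd n S v x = Λ (fun j => hDelta lXd rXd n (F j) v x) := by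
  have : (fun j => hDelta lXd rXd n (F j) v x) =
      (fun j => F j (Fin.tail v) (rX x (v 0))) +
      (∑ i : Fin n, ((-1 : ℂ) ^ (i.val + 1)) • (fun j => F j (mergeAt v i) x)) +
      ((-1 : ℂ) ^ (n + 1)) • (fun j => F j (Fin.init v) (lX (v (Fin.last n)) x)) := by
    funext j
    simp [hDelta, hlXd, hrXd, ContinuousLinearMap.sum_apply]
  rw [this, map_add, map_add, map_sum]
  simp only [map_smul, ← hS]
  simp [hDelta, hlXd, hrXd, ContinuousLinearMap.sum_apply]

theorem hDelta_comp (lW : A →L[ℂ] W →L[ℂ] W) (rW : W →L[ℂ] A →L[ℂ] W) (n : ℕ)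
    (R : W →L[ℂ] W) (hR : ∀ w a, R (rW w a) = rW (R w) a)
    (T : Cochain A W n) (v : Fin (n + 1) → A) :
    R (hDelta lW rW n T v - lW (v 0) (T (Fin.tail v))) =
      hDelta lW rW n (R.compContinuousMultilinearMap T) v - lW (v 0) (R (T (Fin.tail v))) := by
  simp [hDelta, hR]
  abel

/-- Let `𝒞` be the bicyclic inverse semigroup (the monoid generated by
`p`, `q` with `qp = 1` and normal forms `pᵐqⁿ`), with set of idempotents `E_𝒞`, and let
`ℓ¹(E_𝒞)` act on `ℓ¹(𝒞)` by multiplication from the right and trivially from the left via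
the augmentation character `f`.  Let `X` be a commutative Banach
`ℓ¹(𝒞)`-`ℓ¹(E_𝒞)`-bimodule which is an `𝓛₁`-space (with `J = J₀`).  Then for every
`k = k₀ + 1 ∈ ℕ`, the `k`-th module cohomology `H^k_{ℓ¹(E_𝒞)}(ℓ¹(𝒞), X*)` vanishes:
every bounded `ℓ¹(E_𝒞)`-module `k`-cocycle with values in `X*` is the coboundary of a
bounded `ℓ¹(E_𝒞)`-module `(k−1)`-cochain. -/
theorem stmt_12
    -- the bicyclic inverse semigroup `𝒞 = {pᵐqⁿ}` with `qp = 1`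
    {C : Type*} [Monoid C] (p q : C)
    (hqp : q * p = 1)
    (hforms : ∀ c : C, ∃ m n : ℕ, c = p ^ m * q ^ n)
    (huniq : ∀ m n m' n' : ℕ, p ^ m * q ^ n = p ^ m' * q ^ n' → m = m' ∧ n = n')
    -- `L = ℓ¹(𝒞)`
    {L : Type*} [NonUnitalNormedRing L] [NormedSpace ℂ L] [IsScalarTower ℂ L L]
    [SMulCommClass ℂ L L] [CompleteSpace L]
    (δ : C → L) (hL : IsL1SemigroupAlgebra C L δ)
    -- `LE = ℓ¹(E_𝒞)`, realized inside `L` via the isometric embedding `κ`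
    {LE : Type*} [NonUnitalNormedRing LE] [NormedSpace ℂ LE] [IsScalarTower ℂ LE LE]
    [SMulCommClass ℂ LE LE] [CompleteSpace LE]
    (δE : {e : C // e * e = e} → LE)
    (hδE_norm : ∀ (F : Finset {e : C // e * e = e}) (c : {e : C // e * e = e} → ℂ),
      ‖∑ e ∈ F, c e • δE e‖ = ∑ e ∈ F, ‖c e‖)
    (hδE_dense : Dense ((Submodule.span ℂ (Set.range δE) : Submodule ℂ LE) : Set LE))
    (κ : LE →L[ℂ] L) (hκ_mul : ∀ x y, κ (x * y) = κ x * κ y) (hκ_iso : ∀ x, ‖κ x‖ = ‖x‖)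
    (hκδ : ∀ e, κ (δE e) = δ e.1)
    -- the augmentation character `f` on `ℓ¹(E_𝒞)`
    (f : LE →L[ℂ] ℂ) (hf_mul : ∀ x y, f (x * y) = f x * f y) (hf_one : ∀ e, f (δE e) = 1)
    -- the right action `ρ` of `ℓ¹(E_𝒞)` on `ℓ¹(𝒞)` (multiplication; the left action is
    -- trivial via `f`)
    (ρ : L →L[ℂ] LE →L[ℂ] L) (hρ : ∀ (a : L) (β : LE), ρ a β = a * κ β)
    -- `J`: the closed ideal generated by the elements `δ_{set} − δ_{st}`, with `J = J₀`
    (J : Submodule ℂ L)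
    (hJ : IsClosedIdealGeneratedBy J
      {x : L | ∃ s t e : C, e * e = e ∧ x = δ (s * e * t) - δ (s * t)})
    (hJ0 : J = (Submodule.span ℂ
      {x : L | ∃ (a : L) (β : LE), x = ρ a β - f β • a}).topologicalClosure)
    -- `X`: a commutative Banach `ℓ¹(𝒞)`-`ℓ¹(E_𝒞)`-bimodule, trivial left `ℓ¹(E_𝒞)`-action
    -- via `f`, and an `𝓛₁`-space
    {X : Type*} [NormedAddCommGroup X] [NormedSpace ℂ X] [CompleteSpace X]
    (lX : L →L[ℂ] X →L[ℂ] X) (rX : X →L[ℂ] L →L[ℂ] X)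
    (hlX : ∀ a b x, lX (a * b) x = lX a (lX b x))
    (hrX : ∀ x a b, rX (rX x a) b = rX x (a * b))
    (hlrX : ∀ a x b, rX (lX a x) b = lX a (rX x b))
    (σX : X →L[ℂ] LE →L[ℂ] X)
    (hσX : ∀ x β, σX x β = f β • x)
    (hcompL : ∀ a β x, f β • lX a x = lX (ρ a β) x)
    (hcompR : ∀ x a β, f β • rX x a = rX x (ρ a β))
    (hX1 : IsL1Space X)
    -- the canonical dual actions of `ℓ¹(𝒞)` on `X* = X →L[ℂ] ℂ`
    (lXd : L →L[ℂ] (X →L[ℂ] ℂ) →L[ℂ] (X →L[ℂ] ℂ))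
    (rXd : (X →L[ℂ] ℂ) →L[ℂ] L →L[ℂ] (X →L[ℂ] ℂ))
    (hlXd : ∀ (a : L) (φ : X →L[ℂ] ℂ) (x : X), lXd a φ x = φ (rX x a))
    (hrXd : ∀ (φ : X →L[ℂ] ℂ) (a : L) (x : X), rXd φ a x = φ (lX a x)) :
    -- conclusion: for every `k = k₀ + 1 ∈ ℕ`, `H^k_{ℓ¹(E_𝒞)}(ℓ¹(𝒞), X*) = 0`: every
    -- module `k`-cocycle is a module `k`-coboundary
    ∀ k₀ : ℕ,
      cocycles lXd rXd (fun j => moduleCochains f ρ j) (k₀ + 1) ≤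
        coboundaries lXd rXd (fun j => moduleCochains f ρ j) k₀ := by
  intro k₀ T hT
  obtain ⟨hTM, hTc⟩ := hT
  obtain ⟨Λ, hΛb, hΛs, hΛc⟩ := exists_banachLimit
  obtain ⟨hδmul, hδnorm, -, hδdense⟩ := hL
  have hδ1 : ∀ c, ‖δ c‖ = 1 := by
    intro c
    simpa using hδnorm {c} (fun _ => 1)
  have hqpj : ∀ j : ℕ, q ^ j * p ^ j = 1 := by
    intro j
    induction j with
    | zero => simp
    | succ j ih =>
      rw [pow_succ, pow_succ', mul_assoc, ← mul_assoc q p, hqp, one_mul, ih]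
  have hpq : (p * q) * (p * q) = p * q := by
    rw [mul_assoc, ← mul_assoc q p, hqp, one_mul]
  -- induction principle for closed linear statements on `L`
  have hdens : ∀ (g h : L →L[ℂ] ℂ), (∀ c, g (δ c) = h (δ c)) → g = h := by
    intro g h hgh
    refine ContinuousLinearMap.ext_on hδdense ?_
    rintro _ ⟨c, rfl⟩
    exact hgh c
  have hone : ∀ a : L, δ 1 * a = a := by
    intro a
    have hcl : IsClosed {a : L | δ 1 * a = a} :=
      isClosed_eq (continuous_const.mul continuous_id) continuous_id
    have hsub : ((Submodule.span ℂ (Set.range δ) : Submodule ℂ L) : Set L) ⊆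
        {a : L | δ 1 * a = a} := by
      intro b hb
      induction hb using Submodule.span_induction with
      | mem x hx => obtain ⟨c, rfl⟩ := hx; simp [hδmul]
      | zero => simp
      | add x y _ _ hx hy =>
        simp only [Set.mem_setOf_eq] at hx hy ⊢
        rw [mul_add, hx, hy]
      | smul c x _ hx =>
        simp only [Set.mem_setOf_eq] at hx ⊢
        rw [mul_smul_comm, hx]
    exact (hcl.closure_subset_iff.2 hsub) (hδdense a)
  have hll : ∀ a b φ, lXd a (lXd b φ) = lXd (a * b) φ := by
    intro a b φ; ext x
    simp only [hlXd, hrX]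
  have hlr : ∀ b φ a, lXd b (rXd φ a) = rXd (lXd b φ) a := by
    intro b φ a; ext x
    simp only [hlXd, hrXd, hlrX]
  -- `pq` acts as `1`
  have hrpq : ∀ x, rX x (δ (p * q)) = rX x (δ 1) := by
    intro x
    have := hcompR x (δ 1) (δE ⟨p * q, hpq⟩)
    rw [hf_one, one_smul, hρ, hκδ, hδmul, one_mul] at this
    exact this.symm
  -- `T` kills `J` in the first variable
  have hTJ : ∀ (w : Fin k₀ → L) (x : X) (a : L), a ∈ J →
      T (Fin.cons a w : Fin (k₀ + 1) → L) x = 0 := by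
    intro w x a ha
    let g : L →L[ℂ] ℂ := (ContinuousLinearMap.apply ℂ ℂ x).comp
      ((ContinuousMultilinearMap.apply ℂ (fun _ : Fin k₀ => L) (X →L[ℂ] ℂ) w).comp T.curryLeft)
    have hg : ∀ a, g a = T (Fin.cons a w : Fin (k₀ + 1) → L) x := fun a => rfl
    have hle : J ≤ LinearMap.ker (g : L →ₗ[ℂ] ℂ) := by
      rw [hJ0]
      refine Submodule.topologicalClosure_minimal _ ?_ g.isClosed_ker
      rw [Submodule.span_le]
      rintro _ ⟨a, β, rfl⟩
      have := hTM (Fin.cons a w) 0 β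
      rw [Fin.cons_zero, Fin.update_cons_zero] at this
      simp only [SetLike.mem_coe, LinearMap.mem_ker, ContinuousLinearMap.coe_coe, map_sub, map_smul,
        hg, this]
      simp
    exact hle ha
  have hTe : ∀ (w : Fin k₀ → L) (x : X) (s t : C),
      T (Fin.cons (δ (s * (p * q) * t)) w : Fin (k₀ + 1) → L) x =
        T (Fin.cons (δ (s * t)) w : Fin (k₀ + 1) → L) x := by
    intro w x s t
    have h1 := hTJ w x _ (hJ.2.1 ⟨s, t, p * q, hpq, rfl⟩)
    have h2 : T (Fin.cons (δ (s * (p * q) * t) - δ (s * t)) w : Fin (k₀ + 1) → L) =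
        T (Fin.cons (δ (s * (p * q) * t)) w : Fin (k₀ + 1) → L) -
          T (Fin.cons (δ (s * t)) w : Fin (k₀ + 1) → L) := by
      have := map_sub T.curryLeft (δ (s * (p * q) * t)) (δ (s * t))
      exact congrArg (fun R : Cochain L (X →L[ℂ] ℂ) k₀ => R w) this
    rw [h2] at h1
    exact sub_eq_zero.1 h1
  -- the basic family
  let Φ : ℕ → L → (Fin k₀ → L) → X → ℂ := fun j a w x =>
    T (Fin.cons (δ (p ^ j) * a) w : Fin (k₀ + 1) → L) (rX x (δ (q ^ j)))
  have hΦb : ∀ a w x j, ‖Φ j a w x‖ ≤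
      (‖T.curryLeft‖ * (∏ i, ‖w i‖) * (‖rX‖ * ‖x‖)) * ‖a‖ := by
    intro a w x j
    have h1 : ‖δ (p ^ j) * a‖ ≤ ‖a‖ := by
      refine (norm_mul_le _ _).trans ?_
      rw [hδ1, one_mul]
    have h2 : ‖T (Fin.cons (δ (p ^ j) * a) w : Fin (k₀ + 1) → L)‖ ≤
        (‖T.curryLeft‖ * ‖a‖) * ∏ i, ‖w i‖ := by
      refine (ContinuousMultilinearMap.le_opNorm (T.curryLeft (δ (p ^ j) * a)) w).trans ?_
      gcongr
      refine (ContinuousLinearMap.le_opNorm _ _).trans ?_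
      gcongr
    have h3 : ‖rX x (δ (q ^ j))‖ ≤ ‖rX‖ * ‖x‖ := by
      refine (ContinuousLinearMap.le_opNorm₂ _ _ _).trans ?_
      rw [hδ1, mul_one]
    calc ‖Φ j a w x‖ ≤ ‖T (Fin.cons (δ (p ^ j) * a) w : Fin (k₀ + 1) → L)‖ *
          ‖rX x (δ (q ^ j))‖ := ContinuousLinearMap.le_opNorm _ _
      _ ≤ ((‖T.curryLeft‖ * ‖a‖) * ∏ i, ‖w i‖) * (‖rX‖ * ‖x‖) := by gcongr
      _ = _ := by ring
  have hΦcov : ∀ (c : C) (w : Fin k₀ → L) (x : X),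
      Λ (fun j => Φ j (δ c) w x) = Λ (fun j => Φ j (δ 1) w (rX x (δ c))) := by
    have hp : ∀ (c : C) (w : Fin k₀ → L) (x : X),
        Λ (fun j => Φ j (δ (p * c)) w x) = Λ (fun j => Φ j (δ c) w (rX x (δ p))) := by
      intro c w x
      rw [← hΛs _ _ (hΦb (δ c) w (rX x (δ p)))]
      congr 1; funext j
      simp only [Φ, hδmul, hrX]
      have h1 : rX x (δ (p * q ^ (j + 1))) = rX x (δ (q ^ j)) := by
        rw [pow_succ', ← mul_assoc, ← hδmul, ← hrX, hrpq, hrX, hδmul, one_mul]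
      rw [h1, pow_succ, mul_assoc]
    have hq : ∀ (c : C) (w : Fin k₀ → L) (x : X),
        Λ (fun j => Φ j (δ (q * c)) w x) = Λ (fun j => Φ j (δ c) w (rX x (δ q))) := by
      intro c w x
      rw [← hΛs _ _ (hΦb (δ (q * c)) w x)]
      congr 1; funext j
      simp only [Φ, hδmul, hrX]
      rw [← pow_succ', ← hTe w _ (p ^ j) c, pow_succ p]
      simp only [mul_assoc]
    have hqn : ∀ (n : ℕ) (w : Fin k₀ → L) (x : X),
        Λ (fun j => Φ j (δ (q ^ n)) w x) = Λ (fun j => Φ j (δ 1) w (rX x (δ (q ^ n)))) := by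
      intro n w
      induction n with
      | zero =>
        intro x
        congr 1; funext j
        simp only [Φ, pow_zero, hrX, hδmul, one_mul]
      | succ n ih =>
        intro x
        rw [pow_succ', hq, ih, hrX, hδmul]
    intro c w
    obtain ⟨m, n, rfl⟩ := hforms c
    induction m with
    | zero => intro x; simpa using hqn n w x
    | succ m ih =>
      intro x
      rw [pow_succ', mul_assoc, hp, ih, hrX, hδmul]
  have hΦall : ∀ (a : L) (w : Fin k₀ → L) (x : X),
      Λ (fun j => Φ j a w x) = Λ (fun j => Φ j (δ 1) w (rX x a)) := by
    intro a w x
    have hadd : ∀ j a b, Φ j (a + b) w x = Φ j a w x + Φ j b w x := by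
      intro j a b
      have := map_add T.curryLeft (δ (p ^ j) * a) (δ (p ^ j) * b)
      have h := congrArg (fun R : Cochain L (X →L[ℂ] ℂ) k₀ => R w (rX x (δ (q ^ j)))) this
      simp only [← mul_add] at h
      exact h
    have hsmul : ∀ j (c : ℂ) a, Φ j (c • a) w x = c • Φ j a w x := by
      intro j c a
      have := map_smul T.curryLeft c (δ (p ^ j) * a)
      have h := congrArg (fun R : Cochain L (X →L[ℂ] ℂ) k₀ => R w (rX x (δ (q ^ j)))) this
      simp only [← mul_smul_comm] at h
      exact h
    let g : L →L[ℂ] ℂ := LinearMap.mkContinuous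
      { toFun := fun a => Λ (fun j => Φ j a w x)
        map_add' := fun a b => by
          rw [← map_add]; congr 1; funext j; exact hadd j a b
        map_smul' := fun c a => by
          rw [RingHom.id_apply, ← map_smul]; congr 1; funext j; exact hsmul j c a }
      _ (fun a => hΛb _ _ (hΦb a w x))
    let h0 : X →L[ℂ] ℂ := LinearMap.mkContinuous
      { toFun := fun y => Λ (fun j => Φ j (δ 1) w y)
        map_add' := fun a b => by
          rw [← map_add]; congr 1; funext j; simp [Φ]
        map_smul' := fun c a => by
          rw [RingHom.id_apply, ← map_smul]; congr 1; funext j; simp [Φ] }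
      (‖T.curryLeft‖ * (∏ i, ‖w i‖) * ‖rX‖)
      (fun y => hΛb _ _ (fun j => by
        refine (hΦb (δ 1) w y j).trans (le_of_eq ?_)
        rw [hδ1]; ring))
    have := hdens g (h0.comp (rX x)) (fun c => hΦcov c w x)
    exact congrArg (fun r : L →L[ℂ] ℂ => r a) this
  -- the averaged cochain
  let F : ℕ → Cochain L (X →L[ℂ] ℂ) k₀ := fun j =>
    (lXd (δ (q ^ j))).compContinuousMultilinearMap (T.curryLeft (δ (p ^ j)))
  have hFb : ∀ j, ‖F j‖ ≤ ‖rX‖ * ‖T.curryLeft‖ := by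
    intro j
    refine (ContinuousLinearMap.norm_compContinuousMultilinearMap_le _ _).trans ?_
    have h1 : ‖lXd (δ (q ^ j))‖ ≤ ‖rX‖ := by
      refine ContinuousLinearMap.opNorm_le_bound _ rX.opNorm_nonneg (fun φ => ?_)
      refine ContinuousLinearMap.opNorm_le_bound _ (by positivity) (fun x => ?_)
      rw [hlXd]
      have h3 : ‖rX x (δ (q ^ j))‖ ≤ ‖rX‖ * ‖x‖ := by
        refine (ContinuousLinearMap.le_opNorm₂ _ _ _).trans ?_
        rw [hδ1, mul_one]
      calc ‖φ (rX x (δ (q ^ j)))‖ ≤ ‖φ‖ * ‖rX x (δ (q ^ j))‖ := φ.le_opNorm _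
        _ ≤ ‖φ‖ * (‖rX‖ * ‖x‖) := by gcongr
        _ = ‖rX‖ * ‖φ‖ * ‖x‖ := by ring
    have h2 : ‖T.curryLeft (δ (p ^ j))‖ ≤ ‖T.curryLeft‖ := by
      simpa [hδ1] using T.curryLeft.le_opNorm (δ (p ^ j))
    gcongr
  obtain ⟨S, hS⟩ := exists_limit_cochain Λ hΛb k₀ F _ hFb
  have hFΦ : ∀ j w x, F j w x = Φ j (δ 1) w x := by
    intro j w x
    simp [F, Φ, hlXd, hδmul]
  -- first identity: `1 · T = δ S`
  have hPT : ∀ v, lXd (δ 1) (T v) = hDelta lXd rXd k₀ S v := by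
    intro v
    have key : ∀ j x, hDelta lXd rXd k₀ (F j) v x =
        lXd (δ 1) (T v) x - Φ j (v 0) (Fin.tail v) x
          + F j (Fin.tail v) (rX x (v 0)) := by
      intro j x
      have h1 := hTc (Fin.cons (δ (p ^ j)) v)
      rw [hDelta_cons] at h1
      have h2 := hDelta_comp lXd rXd k₀ (lXd (δ (q ^ j))) (fun w a => hlr _ _ _)
        (T.curryLeft (δ (p ^ j))) v
      have h3 : hDelta lXd rXd k₀ (T.curryLeft (δ (p ^ j))) v -
          lXd (v 0) (T.curryLeft (δ (p ^ j)) (Fin.tail v)) =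
          lXd (δ (p ^ j)) (T v) - T (Fin.cons (δ (p ^ j) * v 0) (Fin.tail v)) := by
        rw [ContinuousMultilinearMap.curryLeft_apply, ← sub_eq_zero, ← neg_eq_zero, ← h1]
        abel
      rw [h3, map_sub, hll, hδmul, hqpj] at h2
      have h4 := congrArg (fun φ : X →L[ℂ] ℂ => φ x) h2
      have h5 : lXd (v 0) (F j (Fin.tail v)) x = F j (Fin.tail v) (rX x (v 0)) := hlXd _ _ _
      have h6 : lXd (δ (q ^ j)) (T (Fin.cons (δ (p ^ j) * v 0) (Fin.tail v))) x =
          Φ j (v 0) (Fin.tail v) x := hlXd _ _ _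
      change lXd (δ 1) (T v) x -
        lXd (δ (q ^ j)) (T (Fin.cons (δ (p ^ j) * v 0) (Fin.tail v))) x =
        hDelta lXd rXd k₀ (F j) v x - lXd (v 0) (F j (Fin.tail v)) x at h4
      rw [h5, h6] at h4
      rw [h4]; ring
    ext x
    rw [hDelta_limit lX rX lXd rXd hlXd hrXd Λ k₀ F S hS v x]
    have : (fun j => hDelta lXd rXd k₀ (F j) v x) =
        (fun _ => lXd (δ 1) (T v) x) - (fun j => Φ j (v 0) (Fin.tail v) x) +
          (fun j => Φ j (δ 1) (Fin.tail v) (rX x (v 0))) := by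
      funext j
      rw [key j x, hFΦ]; rfl
    rw [this, map_add, map_sub, hΛc, hΦall]
    ring
  -- second identity
  let R : (X →L[ℂ] ℂ) →L[ℂ] (X →L[ℂ] ℂ) := lXd (δ 1) - ContinuousLinearMap.id ℂ _
  have hRa : ∀ φ, R φ = lXd (δ 1) φ - φ := fun φ => rfl
  let S' : Cochain L (X →L[ℂ] ℂ) k₀ := R.compContinuousMultilinearMap (T.curryLeft (δ 1))
  have hS'a : ∀ w, S' w = R (T (Fin.cons (δ 1) w)) := fun w => rfl
  have hone' : ∀ a : L, a * δ 1 = a := by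
    intro a
    have hcl : IsClosed {a : L | a * δ 1 = a} :=
      isClosed_eq (continuous_id.mul continuous_const) continuous_id
    have hsub : ((Submodule.span ℂ (Set.range δ) : Submodule ℂ L) : Set L) ⊆
        {a : L | a * δ 1 = a} := by
      intro b hb
      induction hb using Submodule.span_induction with
      | mem x hx => obtain ⟨c, rfl⟩ := hx; simp [hδmul]
      | zero => simp
      | add x y _ _ hx hy =>
        simp only [Set.mem_setOf_eq] at hx hy ⊢
        rw [add_mul, hx, hy]
      | smul c x _ hx =>
        simp only [Set.mem_setOf_eq] at hx ⊢
        rw [smul_mul_assoc, hx]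
    exact (hcl.closure_subset_iff.2 hsub) (hδdense a)
  have hRT : ∀ v, T v - lXd (δ 1) (T v) = hDelta lXd rXd k₀ S' v := by
    intro v
    have h1 := hTc (Fin.cons (δ 1) v)
    rw [hDelta_cons, hone, Fin.cons_self_tail] at h1
    have h2 := hDelta_comp lXd rXd k₀ R (fun w a => by
      rw [hRa, hRa, hlr, map_sub]; rfl) (T.curryLeft (δ 1)) v
    have h3 : hDelta lXd rXd k₀ (T.curryLeft (δ 1)) v -
        lXd (v 0) (T.curryLeft (δ 1) (Fin.tail v)) = lXd (δ 1) (T v) - T v := by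
      rw [ContinuousMultilinearMap.curryLeft_apply, ← sub_eq_zero, ← neg_eq_zero, ← h1]
      abel
    have h4 : lXd (v 0) (R (T.curryLeft (δ 1) (Fin.tail v))) = 0 := by
      rw [hRa, map_sub, hll, hone', sub_self]
    rw [h3, h4, sub_zero, hRa, map_sub, hll, hone] at h2
    change _ = hDelta lXd rXd k₀ S' v at h2
    rw [← h2]; abel
  -- module property
  have hTM' : ∀ (a : L) (v : Fin k₀ → L) (i : Fin k₀) (α : LE),
      T (Fin.cons a (Function.update v i (ρ (v i) α)) : Fin (k₀ + 1) → L) =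
        f α • T (Fin.cons a v : Fin (k₀ + 1) → L) := by
    intro a v i α
    have := hTM (Fin.cons a v) i.succ α
    rw [Fin.cons_succ, ← Fin.cons_update] at this
    exact this
  refine ⟨S + S', Submodule.add_mem _ ?_ ?_, fun v => ?_⟩
  · intro v i α
    ext x
    have : (fun j => F j (Function.update v i (ρ (v i) α)) x) = f α • (fun j => F j v x) := by
      funext j
      change lXd (δ (q ^ j)) (T (Fin.cons (δ (p ^ j)) _)) x =
        f α • lXd (δ (q ^ j)) (T (Fin.cons (δ (p ^ j)) v)) x
      rw [hTM', map_smul]; rfl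
    rw [hS, this, map_smul, ← hS]; rfl
  · intro v i α
    rw [hS'a, hTM', map_smul, ← hS'a]
  · rw [hDelta_add, ← hPT, ← hRT]
    abel
end
end

section
/- For every n ∈ ℕ ∪ {0}, the second module cohomology group H²_{ℓ¹(E)}(ℓ¹(S), ℓ¹(G_S)^{(2n+1)}) is a Banach space; that is, the space of coboundaries is closed in the space of bounded ℓ¹(E)-module 2-cocycles from ℓ¹(S) × ℓ¹(S) into ℓ¹(G_S)^{(2n+1)}. -/
noncomputable section

/-- A Banach space bundled with its structure. -/
structure BanachPkg where
  carrier : Type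
  [grp : NormedAddCommGroup carrier]
  [mod : NormedSpace ℂ carrier]
  [cpl : CompleteSpace carrier]

attribute [instance] BanachPkg.grp BanachPkg.mod BanachPkg.cpl


/-- A cone with Riesz decomposition, bounded generation, uniqueness and normality. -/
structure GoodCone {V : Type*} [NormedAddCommGroup V] [NormedSpace ℂ V]
    (P : AddSubmonoid V) (C : ℝ) : Prop where
  nonneg : 0 ≤ C
  riesz : ∀ x ∈ P, ∀ y ∈ P, ∀ z ∈ P, y + z - x ∈ P →
    ∃ x₁ ∈ P, ∃ x₂ ∈ P, x = x₁ + x₂ ∧ y - x₁ ∈ P ∧ z - x₂ ∈ P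
  gen : ∀ v : V, ∃ p₁ p₂ p₃ p₄ : V, (p₁ ∈ P ∧ p₂ ∈ P ∧ p₃ ∈ P ∧ p₄ ∈ P) ∧
    v = p₁ - p₂ + Complex.I • (p₃ - p₄) ∧
    (‖p₁‖ ≤ C * ‖v‖ ∧ ‖p₂‖ ≤ C * ‖v‖ ∧ ‖p₃‖ ≤ C * ‖v‖ ∧ ‖p₄‖ ≤ C * ‖v‖)
  uniq : ∀ p₁ ∈ P, ∀ p₂ ∈ P, ∀ p₃ ∈ P, ∀ p₄ ∈ P,
    p₁ - p₂ + Complex.I • (p₃ - p₄) = 0 → p₁ = p₂ ∧ p₃ = p₄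
  normal : ∀ x ∈ P, ∀ y, y - x ∈ P → ‖x‖ ≤ C * ‖y‖

section abstract_cone

variable {V : Type*} [NormedAddCommGroup V] [NormedSpace ℂ V] {P : AddSubmonoid V} {C : ℝ}

/-- Bound of a functional from a bound on the cone. -/
theorem GoodCone.bound (h : GoodCone P C) (U : V →L[ℂ] ℂ) (B : ℝ) (hB : 0 ≤ B)
    (hU : ∀ p ∈ P, ‖U p‖ ≤ B * ‖p‖) : ‖U‖ ≤ 4 * C * B := by
  have hC := h.nonneg
  refine U.opNorm_le_bound (by positivity) fun v => ?_
  obtain ⟨p₁, p₂, p₃, p₄, ⟨h1, h2, h3, h4⟩, hv, n1, n2, n3, n4⟩ := h.gen v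
  have b1 := (hU _ h1).trans (mul_le_mul_of_nonneg_left n1 hB)
  have b2 := (hU _ h2).trans (mul_le_mul_of_nonneg_left n2 hB)
  have b3 := (hU _ h3).trans (mul_le_mul_of_nonneg_left n3 hB)
  have b4 := (hU _ h4).trans (mul_le_mul_of_nonneg_left n4 hB)
  have e : U v = U p₁ - U p₂ + Complex.I * (U p₃ - U p₄) := by
    conv_lhs => rw [hv]
    simp
  have : ‖U v‖ ≤ ‖U p₁‖ + ‖U p₂‖ + (‖U p₃‖ + ‖U p₄‖) := by
    rw [e]
    refine (norm_add_le _ _).trans (add_le_add (norm_sub_le _ _) ?_)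
    rw [norm_mul, Complex.norm_I, one_mul]
    exact norm_sub_le _ _
  linarith

theorem GoodCone.ext' (h : GoodCone P C) {U U' : V →L[ℂ] ℂ}
    (hU : ∀ p ∈ P, U p = U' p) : U = U' := by
  ext v
  obtain ⟨p₁, p₂, p₃, p₄, ⟨h1, h2, h3, h4⟩, hv, -⟩ := h.gen v
  rw [hv]
  simp [hU _ h1, hU _ h2, hU _ h3, hU _ h4]

/-- Extension of a bounded additive function on the cone to a continuous linear functional. -/
theorem GoodCone.extend (h : GoodCone P C) (u : V → ℝ) (B : ℝ) (hB : 0 ≤ B)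
    (hadd : ∀ p ∈ P, ∀ q ∈ P, u (p + q) = u p + u q) (hb : ∀ p ∈ P, |u p| ≤ B * ‖p‖) :
    ∃ U : V →L[ℂ] ℂ, (∀ p ∈ P, U p = (u p : ℂ)) ∧ ‖U‖ ≤ 4 * C * B := by
  have hC := h.nonneg
  choose d₁ d₂ d₃ d₄ hP hd hn using h.gen
  let U₀ : V → ℂ := fun v =>
    ((u (d₁ v) : ℂ) - u (d₂ v)) + Complex.I * ((u (d₃ v) : ℂ) - u (d₄ v))
  have key : ∀ p₁ ∈ P, ∀ p₂ ∈ P, ∀ p₃ ∈ P, ∀ p₄ ∈ P,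
      U₀ (p₁ - p₂ + Complex.I • (p₃ - p₄)) =
        ((u p₁ : ℂ) - u p₂) + Complex.I * ((u p₃ : ℂ) - u p₄) := by
    intro p₁ h1 p₂ h2 p₃ h3 p₄ h4
    set v := p₁ - p₂ + Complex.I • (p₃ - p₄) with hv
    obtain ⟨k1, k2, k3, k4⟩ := hP v
    have e := h.uniq (d₁ v + p₂) (add_mem k1 h2) (p₁ + d₂ v) (add_mem h1 k2)
      (d₃ v + p₄) (add_mem k3 h4) (p₃ + d₄ v) (add_mem h3 k4) (by
        have e1 : d₁ v - d₂ v + Complex.I • (d₃ v - d₄ v) - (p₁ - p₂ + Complex.I • (p₃ - p₄)) = 0 := by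
          rw [← hd v, hv, sub_self]
        rw [← e1]; simp only [smul_sub, smul_add]; abel)
    have e1 := congrArg u e.1
    have e2 := congrArg u e.2
    rw [hadd _ k1 _ h2, hadd _ h1 _ k2] at e1
    rw [hadd _ k3 _ h4, hadd _ h3 _ k4] at e2
    have e1' : (u (d₁ v) : ℂ) + u p₂ = u p₁ + u (d₂ v) := by exact_mod_cast e1
    have e2' : (u (d₃ v) : ℂ) + u p₄ = u p₃ + u (d₄ v) := by exact_mod_cast e2
    simp only [U₀]
    linear_combination e1' + Complex.I * e2'
  have u0 : u 0 = 0 := by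
    have := hadd 0 P.zero_mem 0 P.zero_mem
    simpa using this
  have Uadd : ∀ v w, U₀ (v + w) = U₀ v + U₀ w := by
    intro v w
    obtain ⟨k1, k2, k3, k4⟩ := hP v
    obtain ⟨l1, l2, l3, l4⟩ := hP w
    have e : v + w = (d₁ v + d₁ w) - (d₂ v + d₂ w) +
        Complex.I • ((d₃ v + d₃ w) - (d₄ v + d₄ w)) := by
      conv_lhs => rw [hd v, hd w]
      simp only [smul_sub, smul_add]; abel
    rw [e, key _ (add_mem k1 l1) _ (add_mem k2 l2) _ (add_mem k3 l3) _ (add_mem k4 l4),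
      hadd _ k1 _ l1, hadd _ k2 _ l2, hadd _ k3 _ l3, hadd _ k4 _ l4]
    simp only [U₀]; push_cast; ring
  have UI : ∀ v, U₀ (Complex.I • v) = Complex.I * U₀ v := by
    intro v
    obtain ⟨k1, k2, k3, k4⟩ := hP v
    have e : Complex.I • v = d₄ v - d₃ v + Complex.I • (d₁ v - d₂ v) := by
      conv_lhs => rw [hd v]
      simp only [smul_sub, smul_add, smul_smul, Complex.I_mul_I, neg_smul, one_smul]; abel
    rw [e, key _ k4 _ k3 _ k1 _ k2]
    simp only [U₀]
    linear_combination (-((u (d₃ v) : ℂ) - u (d₄ v))) * Complex.I_mul_I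
  have Ub : ∀ v, ‖U₀ v‖ ≤ 4 * C * B * ‖v‖ := by
    intro v
    obtain ⟨k1, k2, k3, k4⟩ := hP v
    obtain ⟨n1, n2, n3, n4⟩ := hn v
    have b1 := (hb _ k1).trans (mul_le_mul_of_nonneg_left n1 hB)
    have b2 := (hb _ k2).trans (mul_le_mul_of_nonneg_left n2 hB)
    have b3 := (hb _ k3).trans (mul_le_mul_of_nonneg_left n3 hB)
    have b4 := (hb _ k4).trans (mul_le_mul_of_nonneg_left n4 hB)
    have : ‖U₀ v‖ ≤ |u (d₁ v)| + |u (d₂ v)| + (|u (d₃ v)| + |u (d₄ v)|) := by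
      refine (norm_add_le _ _).trans (add_le_add ?_ ?_)
      · refine (norm_sub_le _ _).trans ?_
        simp
      · rw [norm_mul, Complex.norm_I, one_mul]
        refine (norm_sub_le _ _).trans ?_
        simp
    linarith
  let U₁ : V →+ ℂ := AddMonoidHom.mk' U₀ Uadd
  have hcont : Continuous U₁ := AddMonoidHomClass.continuous_of_bound U₁ _ Ub
  have Ur : ∀ (r : ℝ) v, U₀ ((r : ℂ) • v) = r * U₀ v := by
    intro r v
    have := map_real_smul U₁ hcont r v
    simpa [U₁] using this
  let U₂ : V →ₗ[ℂ] ℂ :=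
    { toFun := U₀
      map_add' := Uadd
      map_smul' := by
        intro c v
        have e : c • v = (c.re : ℂ) • v + (c.im : ℂ) • (Complex.I • v) := by
          rw [smul_smul, ← add_smul, Complex.re_add_im]
        rw [e, Uadd, Ur, Ur, UI]
        simp only [RingHom.id_apply, smul_eq_mul]
        linear_combination U₀ v * Complex.re_add_im c }
  refine ⟨U₂.mkContinuous _ Ub, ?_, LinearMap.mkContinuous_norm_le _ (by positivity) _⟩
  intro p hp
  have := key p hp 0 P.zero_mem 0 P.zero_mem 0 P.zero_mem
  change U₀ p = _
  simpa [u0] using this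

theorem GoodCone.refine_list (h : GoodCone P C) {ι : Type*} (φ : ι → V → ℝ)
    (hadd : ∀ i, ∀ p ∈ P, ∀ q ∈ P, φ i (p + q) = φ i p + φ i q)
    (l : List (ι × V)) : ∀ p ∈ P, ∀ q ∈ P, (∀ x ∈ l, x.2 ∈ P) →
    (l.map fun x => x.2).sum = p + q →
    ∃ l₁ l₂ : List (ι × V), (∀ x ∈ l₁, x.2 ∈ P) ∧ (∀ x ∈ l₂, x.2 ∈ P) ∧
      (l₁.map fun x => x.2).sum = p ∧ (l₂.map fun x => x.2).sum = q ∧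
      (l.map fun x => φ x.1 x.2).sum =
        (l₁.map fun x => φ x.1 x.2).sum + (l₂.map fun x => φ x.1 x.2).sum := by
  induction l with
  | nil =>
    intro p hp q hq _ hs
    simp only [List.map_nil, List.sum_nil] at hs
    have hp0 : p = 0 := by
      have := h.normal p hp 0 (by rw [hs]; simpa using hq)
      simpa using this
    have hq0 : q = 0 := by simpa [hp0] using hs.symm
    exact ⟨[], [], by simp, by simp, by simp [hp0], by simp [hq0], by simp⟩
  | cons a l ih =>
    obtain ⟨t, x⟩ := a
    intro p hp q hq hl hs
    simp only [List.mem_cons, forall_eq_or_imp] at hl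
    simp only [List.map_cons, List.sum_cons] at hs
    have hr : (l.map fun x => x.2).sum ∈ P := by
      apply P.list_sum_mem
      intro y hy
      obtain ⟨z, hz, rfl⟩ := List.mem_map.1 hy
      exact hl.2 z hz
    obtain ⟨x₁, h1, x₂, h2, e, k1, k2⟩ := h.riesz x hl.1 p hp q hq (by
      rw [← hs]; simpa using hr)
    obtain ⟨l₁, l₂, m1, m2, s1, s2, s3⟩ := ih _ k1 _ k2 hl.2 (by
      have : (l.map fun x => x.2).sum = p + q - x := by rw [← hs]; abel
      rw [this, e]; abel)
    refine ⟨(t, x₁) :: l₁, (t, x₂) :: l₂, ?_, ?_, ?_, ?_, ?_⟩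
    · exact List.forall_mem_cons.2 ⟨h1, m1⟩
    · exact List.forall_mem_cons.2 ⟨h2, m2⟩
    · simp [s1]
    · simp [s2]
    · simp only [List.map_cons, List.sum_cons]
      rw [s3, e, hadd t _ h1 _ h2]; ring

/-- Riesz-Kantorovich: suprema of families of functionals. -/
theorem GoodCone.sup (h : GoodCone P C) {ι : Type*} (φ : ι → V → ℝ)
    (hadd : ∀ i, ∀ p ∈ P, ∀ q ∈ P, φ i (p + q) = φ i p + φ i q)
    (B : ℝ) (hB : 0 ≤ B)
    (hup : ∀ l : List (ι × V), (∀ x ∈ l, x.2 ∈ P) →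
      (l.map fun x => φ x.1 x.2).sum ≤ B * ‖(l.map fun x => x.2).sum‖)
    (i₀ : ι) (hlow : ∀ p ∈ P, -(B * ‖p‖) ≤ φ i₀ p) :
    ∃ U : V →L[ℂ] ℂ, ‖U‖ ≤ 4 * C * B ∧ (∀ p ∈ P, (U p).im = 0) ∧
      (∀ i, ∀ p ∈ P, φ i p ≤ (U p).re) ∧
      ∀ k : V → ℝ, (∀ p ∈ P, ∀ q ∈ P, k (p + q) = k p + k q) →
        (∀ i, ∀ p ∈ P, φ i p ≤ k p) → ∀ p ∈ P, (U p).re ≤ k p := by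
  let A : V → Set ℝ := fun p => {r | ∃ l : List (ι × V), (∀ x ∈ l, x.2 ∈ P) ∧
    (l.map fun x => x.2).sum = p ∧ (l.map fun x => φ x.1 x.2).sum = r}
  have hbdd : ∀ p, BddAbove (A p) := by
    intro p
    refine ⟨B * ‖p‖, ?_⟩
    rintro r ⟨l, hl, rfl, rfl⟩
    exact hup l hl
  have hsing : ∀ i, ∀ p ∈ P, φ i p ∈ A p := by
    intro i p hp
    exact ⟨[(i, p)], by simpa using hp, by simp, by simp⟩
  have hne : ∀ p ∈ P, (A p).Nonempty := fun p hp => ⟨_, hsing i₀ p hp⟩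
  have hge : ∀ i, ∀ p ∈ P, φ i p ≤ sSup (A p) := fun i p hp =>
    le_csSup (hbdd p) (hsing i p hp)
  obtain ⟨U, hU, hUn⟩ := h.extend (fun p => sSup (A p)) B hB (by
    intro p hp q hq
    apply le_antisymm
    · apply csSup_le (hne _ (add_mem hp hq))
      rintro r ⟨l, hl, hs, rfl⟩
      obtain ⟨l₁, l₂, m1, m2, s1, s2, s3⟩ := h.refine_list φ hadd l p hp q hq hl hs
      rw [s3]
      exact add_le_add (le_csSup (hbdd p) ⟨l₁, m1, s1, rfl⟩)
        (le_csSup (hbdd q) ⟨l₂, m2, s2, rfl⟩)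
    · rw [← le_sub_iff_add_le]
      apply csSup_le (hne p hp)
      rintro r ⟨l₁, m1, s1, rfl⟩
      rw [le_sub_comm]
      apply csSup_le (hne q hq)
      rintro r ⟨l₂, m2, s2, rfl⟩
      rw [le_sub_iff_add_le']
      apply le_csSup (hbdd _)
      refine ⟨l₁ ++ l₂, ?_, by simp [s1, s2], by simp⟩
      intro x hx
      rcases List.mem_append.1 hx with hx | hx
      · exact m1 x hx
      · exact m2 x hx) (by
    intro p hp
    rw [abs_le]
    refine ⟨(hlow p hp).trans (hge i₀ p hp), csSup_le (hne p hp) ?_⟩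
    rintro r ⟨l, hl, rfl, rfl⟩
    exact hup l hl)
  refine ⟨U, hUn, ?_, ?_, ?_⟩
  · intro p hp; rw [hU p hp]; simp
  · intro i p hp; rw [hU p hp]; simpa using hge i p hp
  · intro k hk hle p hp
    rw [hU p hp]
    simp only [Complex.ofReal_re]
    apply csSup_le (hne p hp)
    rintro r ⟨l, hl, rfl, rfl⟩
    have k0 : k 0 = 0 := by simpa using hk 0 P.zero_mem 0 P.zero_mem
    clear hp
    induction l with
    | nil => simp [k0]
    | cons a l ih =>
      simp only [List.mem_cons, forall_eq_or_imp] at hl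
      have hr : (l.map fun x => x.2).sum ∈ P := by
        apply P.list_sum_mem
        intro y hy
        obtain ⟨z, hz, rfl⟩ := List.mem_map.1 hy
        exact hl.2 z hz
      simp only [List.map_cons, List.sum_cons]
      rw [hk _ hl.1 _ hr]
      exact add_le_add (hle _ _ hl.1) (ih hl.2)


theorem GoodCone.posPart (h : GoodCone P C) (f : V →L[ℂ] ℂ) :
    ∃ g : V →L[ℂ] ℂ, ‖g‖ ≤ 4 * C * (C * ‖f‖) ∧ (∀ p ∈ P, (g p).im = 0) ∧
      (∀ p ∈ P, 0 ≤ (g p).re) ∧ (∀ p ∈ P, (f p).re ≤ (g p).re) ∧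
      ∀ k : V →L[ℂ] ℂ, (∀ p ∈ P, 0 ≤ (k p).re) → (∀ p ∈ P, (f p).re ≤ (k p).re) →
        ∀ p ∈ P, (g p).re ≤ (k p).re := by
  have hC := h.nonneg
  let φ : Bool → V → ℝ := fun b p => if b then (f p).re else 0
  obtain ⟨g, hgn, hgi, hge, hgl⟩ := h.sup φ (by
      intro i p _ q _
      cases i <;> simp [φ]) (C * ‖f‖) (by positivity) (by
      intro l hl
      have : ∃ q ∈ P, (l.map fun x => x.2).sum - q ∈ P ∧
          (l.map fun x => φ x.1 x.2).sum = (f q).re := by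
        induction l with
        | nil => exact ⟨0, P.zero_mem, by simp [P.zero_mem], by simp⟩
        | cons a l ih =>
          obtain ⟨b, x⟩ := a
          simp only [List.mem_cons, forall_eq_or_imp] at hl
          obtain ⟨q, hq, hq1, hq2⟩ := ih hl.2
          simp only [List.map_cons, List.sum_cons]
          cases b with
          | false =>
            refine ⟨q, hq, ?_, by simp [φ, hq2]⟩
            rw [add_sub_assoc]
            exact add_mem hl.1 hq1
          | true =>
            refine ⟨x + q, add_mem hl.1 hq, ?_, by simp [φ, hq2]⟩
            rw [add_sub_add_left_eq_sub]
            exact hq1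
      obtain ⟨q, hq, hq1, hq2⟩ := this
      rw [hq2]
      calc (f q).re ≤ ‖f q‖ := Complex.re_le_norm _
        _ ≤ ‖f‖ * ‖q‖ := f.le_opNorm q
        _ ≤ ‖f‖ * (C * ‖(l.map fun x => x.2).sum‖) :=
          mul_le_mul_of_nonneg_left (h.normal _ hq _ hq1) (norm_nonneg _)
        _ = _ := by ring) false (by
      intro p _
      have : 0 ≤ C * ‖f‖ * ‖p‖ := by positivity
      simpa [φ] using this)
  refine ⟨g, hgn, hgi, fun p hp => by simpa [φ] using hge false p hp,
    fun p hp => by simpa [φ] using hge true p hp, fun k hk0 hkf => ?_⟩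
  refine hgl (fun p => (k p).re) (by intros; simp) ?_
  intro i p hp
  cases i
  · simpa [φ] using hk0 p hp
  · simpa [φ] using hkf p hp

theorem GoodCone.realPart (h : GoodCone P C) (f : V →L[ℂ] ℂ) :
    ∃ g : V →L[ℂ] ℂ, ‖g‖ ≤ 4 * C * ‖f‖ ∧ ∀ p ∈ P, g p = ((f p).re : ℂ) := by
  obtain ⟨g, h1, h2⟩ := h.extend (fun p => (f p).re) ‖f‖ (norm_nonneg _) (by intros; simp)
    (fun p _ => (Complex.abs_re_le_norm _).trans (f.le_opNorm p))
  exact ⟨g, h2, h1⟩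

/-- The dual cone, transported to a realization `X` of the dual. -/
def dualCone {X : Type*} [NormedAddCommGroup X] [NormedSpace ℂ X]
    (e : X ≃ₗᵢ[ℂ] (V →L[ℂ] ℂ)) (P : AddSubmonoid V) : AddSubmonoid X where
  carrier := {x | ∀ p ∈ P, 0 ≤ (e x p).re ∧ (e x p).im = 0}
  zero_mem' := by intro p _; simp
  add_mem' := by
    intro a b ha hb p hp
    have := ha p hp
    have := hb p hp
    simp only [map_add, add_apply, Complex.add_re, Complex.add_im]
    constructor <;> linarith

theorem mem_dualCone {X : Type*} [NormedAddCommGroup X] [NormedSpace ℂ X]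
    {e : X ≃ₗᵢ[ℂ] (V →L[ℂ] ℂ)} {x : X} :
    x ∈ dualCone e P ↔ ∀ p ∈ P, 0 ≤ (e x p).re ∧ (e x p).im = 0 := Iff.rfl

theorem GoodCone.decomp (h : GoodCone P C) (f : V →L[ℂ] ℂ) :
    ∃ g₁ g₂ : V →L[ℂ] ℂ, ‖g₁‖ ≤ (4 * C * C + 4 * C) * ‖f‖ ∧
      ‖g₂‖ ≤ (4 * C * C + 4 * C) * ‖f‖ ∧
      ∀ p ∈ P, (0 ≤ (g₁ p).re ∧ (g₁ p).im = 0) ∧ (0 ≤ (g₂ p).re ∧ (g₂ p).im = 0) ∧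
        g₁ p - g₂ p = ((f p).re : ℂ) := by
  have hC := h.nonneg
  obtain ⟨U, hUn, hU⟩ := h.realPart f
  obtain ⟨g, hgn, hgi, hg0, hgf, -⟩ := h.posPart f
  refine ⟨g, g - U, ?_, ?_, ?_⟩
  · have : 0 ≤ 4 * C * ‖f‖ := by positivity
    linarith
  · have := norm_sub_le g U
    linarith
  · intro p hp
    have := hgf p hp
    refine ⟨⟨hg0 p hp, hgi p hp⟩, ⟨?_, ?_⟩, ?_⟩
    · simp [hU p hp, this]
    · simp [hU p hp, hgi p hp]
    · simp [hU p hp]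

theorem GoodCone.dual (h : GoodCone P C) {X : Type*} [NormedAddCommGroup X] [NormedSpace ℂ X]
    (e : X ≃ₗᵢ[ℂ] (V →L[ℂ] ℂ)) : GoodCone (dualCone e P) (4 * C * C + 4 * C) := by
  have hC := h.nonneg
  refine ⟨by positivity, ?_, ?_, ?_, ?_⟩
  · intro x hx y hy z hz hyzx
    obtain ⟨g, -, hgi, hg0, hgf, hgl⟩ := h.posPart (e (x - y))
    have a1 := hgl (e z) (fun p hp => (hz p hp).1) (by
      intro p hp
      have := (hyzx p hp).1
      simp at this ⊢
      linarith)
    have a2 := hgl (e x) (fun p hp => (hx p hp).1) (by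
      intro p hp
      have := (hy p hp).1
      simp at this ⊢
      linarith)
    refine ⟨x - e.symm g, ?_, e.symm g, ?_, by simp, ?_, ?_⟩
    · intro p hp
      have := a2 p hp
      have := (hx p hp).2
      have := hgi p hp
      simp
      constructor <;> linarith
    · intro p hp
      simpa using ⟨hg0 p hp, hgi p hp⟩
    · intro p hp
      have := hgf p hp
      have := (hx p hp).2
      have := (hy p hp).2
      have := hgi p hp
      simp at *
      constructor <;> linarith
    · intro p hp
      have := a1 p hp
      have := (hz p hp).2
      have := hgi p hp
      simp
      constructor <;> linarith
  · intro x
    obtain ⟨g₁, g₂, n1, n2, hg⟩ := h.decomp (e x)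
    obtain ⟨g₃, g₄, n3, n4, hg'⟩ := h.decomp (-Complex.I • e x)
    have hn : ‖-Complex.I • e x‖ = ‖x‖ := by
      rw [norm_smul]; simp
    rw [hn] at n3 n4
    rw [e.norm_map] at n1 n2
    refine ⟨e.symm g₁, e.symm g₂, e.symm g₃, e.symm g₄, ⟨?_, ?_, ?_, ?_⟩, ?_, ?_, ?_, ?_, ?_⟩
    · intro p hp; simpa using (hg p hp).1
    · intro p hp; simpa using (hg p hp).2.1
    · intro p hp; simpa using (hg' p hp).1
    · intro p hp; simpa using (hg' p hp).2.1
    · apply e.injective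
      apply h.ext'
      intro p hp
      have e1 := (hg p hp).2.2
      have e2 := (hg' p hp).2.2
      have e3 : ((((-Complex.I • e x) p).re : ℝ) : ℂ) = ((e x p).im : ℂ) := by
        simp
      rw [e3] at e2
      simp only [map_add, map_sub, map_smul, LinearIsometryEquiv.apply_symm_apply,
        add_apply, sub_apply,
        smul_apply, smul_eq_mul]
      rw [e1, e2]
      conv_lhs => rw [← Complex.re_add_im (e x p)]
      ring
    all_goals simpa
  · intro p₁ h1 p₂ h2 p₃ h3 p₄ h4 heq
    have key : ∀ p ∈ P, e p₁ p = e p₂ p ∧ e p₃ p = e p₄ p := by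
      intro p hp
      have := congrArg (fun x => e x p) heq
      simp only [map_add, map_sub, map_smul, add_apply,
        sub_apply, smul_apply, smul_eq_mul, map_zero,
        zero_apply] at this
      have r := congrArg Complex.re this
      have i := congrArg Complex.im this
      have := (h1 p hp).2
      have := (h2 p hp).2
      have := (h3 p hp).2
      have := (h4 p hp).2
      simp at r i
      constructor <;> apply Complex.ext <;> linarith
    exact ⟨e.injective (h.ext' fun p hp => (key p hp).1),
      e.injective (h.ext' fun p hp => (key p hp).2)⟩
  · intro x hx y hyx
    have := h.bound (e x) ‖y‖ (norm_nonneg _) (by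
      intro p hp
      have e1 : e x p = ((e x p).re : ℂ) := by
        apply Complex.ext <;> simp [(hx p hp).2]
      have h2 := (hyx p hp).1
      have h3 : (e y p).re ≤ ‖e y‖ * ‖p‖ := (Complex.re_le_norm _).trans ((e y).le_opNorm p)
      rw [e.norm_map] at h3
      rw [e1, Complex.norm_real, Real.norm_of_nonneg (hx p hp).1]
      simp at h2
      linarith)
    rw [e.norm_map] at this
    have : 0 ≤ 4 * C * C * ‖y‖ := by positivity
    linarith

/-- Cones on which the norm is dominated by a functional. -/
def HasUnit (P : AddSubmonoid V) : Prop :=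
  ∃ e : V →L[ℂ] ℂ, ∀ p ∈ P, (e p).im = 0 ∧ ‖p‖ ≤ (e p).re

theorem HasUnit.bidual (hu : HasUnit P) {X Y : Type*} [NormedAddCommGroup X] [NormedSpace ℂ X]
    [NormedAddCommGroup Y] [NormedSpace ℂ Y]
    (e : X ≃ₗᵢ[ℂ] (V →L[ℂ] ℂ)) (e' : Y ≃ₗᵢ[ℂ] (X →L[ℂ] ℂ)) {C' : ℝ}
    (h' : GoodCone (dualCone e P) C') : HasUnit (dualCone e' (dualCone e P)) := by
  obtain ⟨w, hw⟩ := hu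
  have hC' := h'.nonneg
  let ev : Y →L[ℂ] ℂ :=
    (ContinuousLinearMap.apply ℂ ℂ (e.symm w)).comp (e'.toLinearIsometry.toContinuousLinearMap)
  have hev : ∀ F, ev F = e' F (e.symm w) := fun F => rfl
  have hwP : e.symm w ∈ dualCone e P := by
    intro p hp
    rw [e.apply_symm_apply]
    exact ⟨(norm_nonneg _).trans (hw p hp).2, (hw p hp).1⟩
  refine ⟨((4 * C' : ℝ) : ℂ) • ev, ?_⟩
  intro F hF
  have hFw := hF _ hwP
  rw [← hev] at hFw
  rw [smul_apply, smul_eq_mul, Complex.re_ofReal_mul, Complex.im_ofReal_mul, hFw.2, mul_zero]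
  refine ⟨rfl, ?_⟩
  rw [← e'.norm_map]
  refine h'.bound (e' F) (ev F).re hFw.1 ?_
  intro f hf
  have h1 : ((‖f‖ : ℂ) • e.symm w - f) ∈ dualCone e P := by
    intro p hp
    have h2 := hf p hp
    have h3 : (e f p).re ≤ ‖e f‖ * ‖p‖ := (Complex.re_le_norm _).trans ((e f).le_opNorm p)
    rw [e.norm_map] at h3
    have h4 := mul_le_mul_of_nonneg_left (hw p hp).2 (norm_nonneg f)
    rw [map_sub, map_smul, e.apply_symm_apply, sub_apply, smul_apply, smul_eq_mul,
      Complex.sub_re, Complex.sub_im, Complex.re_ofReal_mul, Complex.im_ofReal_mul,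
      (hw p hp).1, h2.2]
    exact ⟨by linarith, by ring⟩
  have h5 := (hF _ h1).1
  rw [map_sub, map_smul, ← hev, smul_eq_mul, Complex.sub_re, Complex.re_ofReal_mul] at h5
  have h6 := hF f hf
  have e1 : e' F f = ((e' F f).re : ℂ) := by
    apply Complex.ext <;> simp [h6.2]
  rw [e1, Complex.norm_real, Real.norm_of_nonneg h6.1]
  linarith

/-- Suprema of bounded families in the dual. -/
theorem GoodCone.sup_bdd (h : GoodCone P C) (hu : HasUnit P) {ι : Type*} (i₀ : ι)
    (φ : ι → V →L[ℂ] ℂ) (M : ℝ) (hM : ∀ i, ‖φ i‖ ≤ M) :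
    ∃ U : V →L[ℂ] ℂ, (∀ p ∈ P, (U p).im = 0) ∧
      (∀ i, ∀ p ∈ P, (φ i p).re ≤ (U p).re) ∧
      ∀ k : V →L[ℂ] ℂ, (∀ i, ∀ p ∈ P, (φ i p).re ≤ (k p).re) →
        ∀ p ∈ P, (U p).re ≤ (k p).re := by
  obtain ⟨e, he⟩ := hu
  have hM0 : 0 ≤ M := (norm_nonneg _).trans (hM i₀)
  have hre : ∀ i p, |(φ i p).re| ≤ M * ‖p‖ := fun i p =>
    (Complex.abs_re_le_norm _).trans (((φ i).le_opNorm p).trans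
      (mul_le_mul_of_nonneg_right (hM i) (norm_nonneg _)))
  have hmax : M * 1 ≤ M * max 1 ‖e‖ := mul_le_mul_of_nonneg_left (le_max_left _ _) hM0
  obtain ⟨U, -, h1, h2, h3⟩ := h.sup (fun i p => (φ i p).re) (by intros; simp)
    (M * max 1 ‖e‖) (by positivity) (by
      intro l hl
      have : (l.map fun x => (φ x.1 x.2).re).sum ≤ M * (e (l.map fun x => x.2).sum).re := by
        induction l with
        | nil => simp
        | cons a l ih =>
          simp only [List.mem_cons, forall_eq_or_imp] at hl
          simp only [List.map_cons, List.sum_cons, map_add, Complex.add_re]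
          have b1 := (le_abs_self _).trans (hre a.1 a.2)
          have b2 := mul_le_mul_of_nonneg_left (he _ hl.1).2 hM0
          have b3 := ih hl.2
          linarith
      refine this.trans ?_
      rw [mul_assoc]
      refine mul_le_mul_of_nonneg_left ?_ hM0
      refine (Complex.re_le_norm _).trans ((e.le_opNorm _).trans ?_)
      exact mul_le_mul_of_nonneg_right (le_max_right _ _) (norm_nonneg _)) i₀ (by
      intro p _
      have := (abs_le.1 (hre i₀ p)).1
      have := mul_le_mul_of_nonneg_right hmax (norm_nonneg p)
      linarith)
  exact ⟨U, h1, h2, fun k hk => h3 (fun p => (k p).re) (by intros; simp) hk⟩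

/-- One real part of the approximation argument. -/
theorem GoodCone.approx_re (h : GoodCone P C) {e : V →L[ℂ] ℂ}
    (he : ∀ p ∈ P, (e p).im = 0 ∧ ‖p‖ ≤ (e p).re) {ι : Type*} (i₀ : ι)
    (φ : ι → V →L[ℂ] ℂ) (M : ℝ) (hM : ∀ i, ‖φ i‖ ≤ M)
    (A B : ι → V →L[ℂ] V) (hA : ∀ s, ∀ p ∈ P, A s p ∈ P) (hB : ∀ s, ∀ p ∈ P, B s p ∈ P)
    (hAB : ∀ s p, A s (B s p) = p) (hBA : ∀ s p, B s (A s p) = p)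
    (m : ι → ι → ι) (ε : ℝ)
    (hε : ∀ s t, ‖(φ t).comp (A s) - φ (m s t) + φ s‖ ≤ ε)
    (hm : ∀ s t, ∃ t', φ (m s t') = φ t) :
    ∃ U : V →L[ℂ] ℂ, (∀ p ∈ P, (U p).im = 0) ∧
      ∀ s, ∀ p ∈ P, |(U p).re - (U (A s p)).re - (φ s p).re| ≤ ε * (e p).re := by
  obtain ⟨U, h1, h2, h3⟩ := h.sup_bdd ⟨e, he⟩ i₀ φ M hM
  have hε0 : 0 ≤ ε := (norm_nonneg _).trans (hε i₀ i₀)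
  have key : ∀ s t, ∀ p ∈ P, |(φ t (A s p)).re - (φ (m s t) p).re + (φ s p).re| ≤ ε * (e p).re := by
    intro s t p hp
    have b := ((φ t).comp (A s) - φ (m s t) + φ s).le_opNorm p
    have b2 := (Complex.abs_re_le_norm _).trans b
    have b3 := mul_le_mul_of_nonneg_right (hε s t) (norm_nonneg p)
    have b4 := mul_le_mul_of_nonneg_left (he p hp).2 hε0
    have b5 : (((φ t).comp (A s) - φ (m s t) + φ s) p).re =
      (φ t (A s p)).re - (φ (m s t) p).re + (φ s p).re := by simp
    rw [b5] at b2
    linarith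
  refine ⟨U, h1, fun s p hp => ?_⟩
  rw [abs_le]
  constructor
  · have := h3 ((U - φ s + (ε : ℂ) • e).comp (B s)) (by
      intro t q hq
      have b1 := (abs_le.1 (key s t _ (hB s q hq))).2
      rw [hAB] at b1
      have b2 := h2 (m s t) _ (hB s q hq)
      rw [ContinuousLinearMap.comp_apply, add_apply, sub_apply, smul_apply, smul_eq_mul,
        Complex.add_re, Complex.sub_re, Complex.re_ofReal_mul]
      linarith) (A s p) (hA s p hp)
    rw [ContinuousLinearMap.comp_apply, add_apply, sub_apply, smul_apply, smul_eq_mul,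
        Complex.add_re, Complex.sub_re, Complex.re_ofReal_mul, hBA] at this
    linarith
  · have := h3 (U.comp (A s) + φ s + (ε : ℂ) • e) (by
      intro t q hq
      obtain ⟨t', ht'⟩ := hm s t
      have b1 := (abs_le.1 (key s t' _ hq)).1
      rw [ht'] at b1
      have b2 := h2 t' _ (hA s q hq)
      rw [add_apply, add_apply, smul_apply, smul_eq_mul, ContinuousLinearMap.comp_apply,
        Complex.add_re, Complex.add_re, Complex.re_ofReal_mul]
      linarith) p hp
    rw [add_apply, add_apply, smul_apply, smul_eq_mul, ContinuousLinearMap.comp_apply,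
        Complex.add_re, Complex.add_re, Complex.re_ofReal_mul] at this
    linarith

/-- The approximation: an almost cocycle is close to an inner one. -/
theorem GoodCone.approx (h : GoodCone P C) (hu : HasUnit P) :
    ∃ K : ℝ, 0 ≤ K ∧ ∀ {ι : Type*} (_ : ι)
    (φ : ι → V →L[ℂ] ℂ) (M : ℝ) (_ : ∀ i, ‖φ i‖ ≤ M)
    (A B : ι → V →L[ℂ] V) (_ : ∀ s, ∀ p ∈ P, A s p ∈ P) (_ : ∀ s, ∀ p ∈ P, B s p ∈ P)
    (_ : ∀ s p, A s (B s p) = p) (_ : ∀ s p, B s (A s p) = p)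
    (m : ι → ι → ι) (ε : ℝ)
    (_ : ∀ s t, ‖(φ t).comp (A s) - φ (m s t) + φ s‖ ≤ ε)
    (_ : ∀ s t, ∃ t', φ (m s t') = φ t),
    ∃ U : V →L[ℂ] ℂ, ∀ s, ‖U - U.comp (A s) - φ s‖ ≤ K * ε := by
  obtain ⟨e, he⟩ := hu
  have hC := h.nonneg
  refine ⟨4 * C * (2 * ‖e‖), by positivity, ?_⟩
  intro ι i₀ φ M hM A B hA hB hAB hBA m ε hε hm
  have hε0 : 0 ≤ ε := (norm_nonneg _).trans (hε i₀ i₀)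
  have hI : ‖-Complex.I‖ = 1 := by simp
  obtain ⟨U₁, r1, k1⟩ := h.approx_re he i₀ φ M hM A B hA hB hAB hBA m ε hε hm
  obtain ⟨U₂, r2, k2⟩ := h.approx_re he i₀ (fun i => -Complex.I • φ i) M
    (by intro i; rw [norm_smul, hI, one_mul]; exact hM i) A B hA hB hAB hBA m ε
    (by
      intro s t
      have : (-Complex.I • φ t).comp (A s) - -Complex.I • φ (m s t) + -Complex.I • φ s =
        -Complex.I • ((φ t).comp (A s) - φ (m s t) + φ s) := by
        ext v; simp; ring
      rw [this, norm_smul, hI, one_mul]; exact hε s t)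
    (by
      intro s t
      obtain ⟨t', ht'⟩ := hm s t
      exact ⟨t', by simp only [ht']⟩)
  refine ⟨U₁ + Complex.I • U₂, fun s => ?_⟩
  have := h.bound (U₁ + Complex.I • U₂ - (U₁ + Complex.I • U₂).comp (A s) - φ s)
    (2 * ‖e‖ * ε) (by positivity) (by
    intro p hp
    have a1 := k1 s p hp
    have a2 := k2 s p hp
    have a3 := r1 p hp
    have a4 := r2 p hp
    have a5 := r1 _ (hA s p hp)
    have a6 := r2 _ (hA s p hp)
    have a7 : (e p).re ≤ ‖e‖ * ‖p‖ := (Complex.re_le_norm _).trans (e.le_opNorm p)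
    have a8 := mul_le_mul_of_nonneg_left a7 hε0
    refine (Complex.norm_le_abs_re_add_abs_im _).trans ?_
    have c1 : ((U₁ + Complex.I • U₂ - (U₁ + Complex.I • U₂).comp (A s) - φ s) p).re =
      (U₁ p).re - (U₁ (A s p)).re - (φ s p).re := by simp [a4, a6]
    have c2 : ((U₁ + Complex.I • U₂ - (U₁ + Complex.I • U₂).comp (A s) - φ s) p).im =
      (U₂ p).re - (U₂ (A s p)).re - ((-Complex.I • φ s) p).re := by simp [a3, a5]
    rw [c1, c2]
    linarith)
  linarith

end abstract_cone

section base_case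

variable {G : Type*}

theorem l1_summable (x : lp (fun _ : G => ℂ) 1) : Summable fun g => ‖x g‖ := by
  have := (lp.memℓp x).summable (by simp)
  simpa using this

theorem l1_norm (x : lp (fun _ : G => ℂ) 1) : ‖x‖ = ∑' g, ‖x g‖ := by
  have := lp.norm_eq_tsum_rpow (p := 1) (by simp) x
  simpa using this

/-- An element of `ℓ¹` from a summable family. -/
def l1mk (f : G → ℂ) (hf : Summable fun g => ‖f g‖) : lp (fun _ : G => ℂ) 1 :=
  ⟨f, memℓp_gen (by simpa using hf)⟩

theorem l1mk_apply (f : G → ℂ) (hf : Summable fun g => ‖f g‖) (g : G) : l1mk f hf g = f g := rfl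

/-- The positive cone of `ℓ¹`. -/
def baseCone {V : Type*} [NormedAddCommGroup V] [NormedSpace ℂ V]
    (Ψ : lp (fun _ : G => ℂ) 1 ≃ₗᵢ[ℂ] V) : AddSubmonoid V where
  carrier := {v | ∀ g, 0 ≤ (Ψ.symm v g).re ∧ (Ψ.symm v g).im = 0}
  zero_mem' := by intro g; simp
  add_mem' := by
    intro a b ha hb g
    have := ha g
    have := hb g
    simp only [map_add, lp.coeFn_add, Pi.add_apply, Complex.add_re, Complex.add_im]
    constructor <;> linarith

theorem baseCone_hasUnit {V : Type*} [NormedAddCommGroup V] [NormedSpace ℂ V]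
    (Ψ : lp (fun _ : G => ℂ) 1 ≃ₗᵢ[ℂ] V) : HasUnit (baseCone Ψ) := by
  let E : lp (fun _ : G => ℂ) 1 →L[ℂ] ℂ := LinearMap.mkContinuous
    { toFun := fun x => ∑' g, x g
      map_add' := by
        intro x y
        simp only [lp.coeFn_add, Pi.add_apply]
        exact (l1_summable x).of_norm.tsum_add (l1_summable y).of_norm
      map_smul' := by
        intro c x
        simp only [lp.coeFn_smul, Pi.smul_apply, RingHom.id_apply]
        exact (l1_summable x).of_norm.tsum_const_smul c } 1 (by
      intro x
      rw [one_mul, l1_norm]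
      exact norm_tsum_le_tsum_norm (l1_summable x))
  refine ⟨E.comp Ψ.symm.toLinearIsometry.toContinuousLinearMap, fun p hp => ?_⟩
  have h1 : (E.comp Ψ.symm.toLinearIsometry.toContinuousLinearMap) p = ∑' g, Ψ.symm p g := rfl
  have h2 : ∀ g, Ψ.symm p g = ((‖Ψ.symm p g‖ : ℝ) : ℂ) := by
    intro g
    have e1 : Ψ.symm p g = ((Ψ.symm p g).re : ℂ) := by
      apply Complex.ext <;> simp [(hp g).2]
    rw [e1, Complex.norm_real, Real.norm_of_nonneg (hp g).1]
  have h3 : (∑' g, Ψ.symm p g) = ((‖p‖ : ℝ) : ℂ) := by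
    rw [← Ψ.symm.norm_map p, l1_norm, Complex.ofReal_tsum]
    exact tsum_congr h2
  rw [h1, h3]
  simp

theorem baseCone_good {V : Type*} [NormedAddCommGroup V] [NormedSpace ℂ V]
    (Ψ : lp (fun _ : G => ℂ) 1 ≃ₗᵢ[ℂ] V) : GoodCone (baseCone Ψ) 1 := by
  have hmk : ∀ (v : V) (f : G → ℝ), (∀ g, |f g| ≤ ‖Ψ.symm v g‖) →
      ∃ p : V, (∀ g, Ψ.symm p g = (f g : ℂ)) ∧ ‖p‖ ≤ 1 * ‖v‖ := by
    intro v f hf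
    have hs : Summable fun g => ‖(f g : ℂ)‖ :=
      Summable.of_nonneg_of_le (fun _ => norm_nonneg _) (by simpa using hf)
        (l1_summable (Ψ.symm v))
    refine ⟨Ψ (l1mk (fun g => (f g : ℂ)) hs), fun g => ?_, ?_⟩
    · rw [Ψ.symm_apply_apply]; rfl
    · rw [Ψ.norm_map, ← Ψ.symm.norm_map v, one_mul, l1_norm, l1_norm]
      exact hs.tsum_le_tsum (by simpa [l1mk_apply] using hf) (l1_summable _)
  have hext : ∀ v w : V, (∀ g, Ψ.symm v g = Ψ.symm w g) → v = w := by
    intro v w hvw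
    apply Ψ.symm.injective
    ext g
    exact hvw g
  refine ⟨zero_le_one, ?_, ?_, ?_, ?_⟩
  · intro x hx y hy z hz hyzx
    obtain ⟨x₁, hx₁, -⟩ := hmk x (fun g => min (Ψ.symm x g).re (Ψ.symm y g).re) (by
      intro g
      rw [abs_of_nonneg (le_min (hx g).1 (hy g).1)]
      exact (min_le_left _ _).trans (Complex.re_le_norm _))
    refine ⟨x₁, ?_, x - x₁, ?_, by abel, ?_, ?_⟩
    · intro g
      simp [hx₁, (hx g).1, (hy g).1]
    · intro g
      simp [hx₁, (hx g).2]
    · intro g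
      simp [hx₁, (hy g).2]
    · intro g
      have h1 := hyzx g
      have h2 := (hz g).1
      simp at h1
      simp [hx₁, (hx g).2, (hz g).2]
      rcases min_choice (Ψ.symm x g).re (Ψ.symm y g).re with h | h <;> rw [h] <;> linarith
  · intro v
    obtain ⟨p₁, h1, n1⟩ := hmk v (fun g => max (Ψ.symm v g).re 0) (fun g => by
      rw [abs_of_nonneg (le_max_right _ _)]
      exact max_le (Complex.re_le_norm _) (norm_nonneg _))
    obtain ⟨p₂, h2, n2⟩ := hmk v (fun g => max (-(Ψ.symm v g).re) 0) (fun g => by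
      rw [abs_of_nonneg (le_max_right _ _)]
      exact max_le ((neg_le_abs _).trans (Complex.abs_re_le_norm _)) (norm_nonneg _))
    obtain ⟨p₃, h3, n3⟩ := hmk v (fun g => max (Ψ.symm v g).im 0) (fun g => by
      rw [abs_of_nonneg (le_max_right _ _)]
      exact max_le (Complex.im_le_norm _) (norm_nonneg _))
    obtain ⟨p₄, h4, n4⟩ := hmk v (fun g => max (-(Ψ.symm v g).im) 0) (fun g => by
      rw [abs_of_nonneg (le_max_right _ _)]
      exact max_le ((neg_le_abs _).trans (Complex.abs_im_le_norm _)) (norm_nonneg _))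
    refine ⟨p₁, p₂, p₃, p₄, ⟨?_, ?_, ?_, ?_⟩, ?_, n1, n2, n3, n4⟩
    · intro g; rw [h1]; simp
    · intro g; rw [h2]; simp
    · intro g; rw [h3]; simp
    · intro g; rw [h4]; simp
    · apply hext
      intro g
      have hr : ∀ r : ℝ, max r 0 - max (-r) 0 = r := fun r => by
        rcases le_total r 0 with h | h
        · rw [max_eq_right h, max_eq_left (by linarith)]; ring
        · rw [max_eq_left h, max_eq_right (by linarith)]; ring
      simp only [map_add, map_sub, map_smul, lp.coeFn_add, lp.coeFn_sub, lp.coeFn_smul,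
        Pi.add_apply, Pi.sub_apply, Pi.smul_apply, h1, h2, h3, h4, smul_eq_mul]
      rw [← Complex.ofReal_sub, ← Complex.ofReal_sub, hr, hr, mul_comm, Complex.re_add_im]
  · intro p₁ h1 p₂ h2 p₃ h3 p₄ h4 heq
    have key : ∀ g, Ψ.symm p₁ g = Ψ.symm p₂ g ∧ Ψ.symm p₃ g = Ψ.symm p₄ g := by
      intro g
      have := congrArg (fun x => Ψ.symm x g) heq
      simp only [map_add, map_sub, map_smul, lp.coeFn_add, lp.coeFn_sub, lp.coeFn_smul,
        Pi.add_apply, Pi.sub_apply, Pi.smul_apply, smul_eq_mul, map_zero, lp.coeFn_zero,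
        Pi.zero_apply] at this
      have r := congrArg Complex.re this
      have i := congrArg Complex.im this
      have := (h1 g).2
      have := (h2 g).2
      have := (h3 g).2
      have := (h4 g).2
      simp at r i
      constructor <;> apply Complex.ext <;> linarith
    exact ⟨hext _ _ fun g => (key g).1, hext _ _ fun g => (key g).2⟩
  · intro x hx y hyx
    rw [one_mul, ← Ψ.symm.norm_map x, ← Ψ.symm.norm_map y, l1_norm, l1_norm]
    refine (l1_summable _).tsum_le_tsum (fun g => ?_) (l1_summable _)
    have h1 := (hyx g).1
    have e1 : Ψ.symm x g = ((Ψ.symm x g).re : ℂ) := by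
      apply Complex.ext <;> simp [(hx g).2]
    rw [e1, Complex.norm_real, Real.norm_of_nonneg (hx g).1]
    have h2 := Complex.re_le_norm (Ψ.symm y g)
    simp at h1
    linarith

theorem l1_realize [Semigroup G] {LG : Type*} [NonUnitalNormedRing LG] [NormedSpace ℂ LG]
    [CompleteSpace LG] (δG : G → LG) (hLG : IsL1SemigroupAlgebra G LG δG) :
    ∃ Ψ : lp (fun _ : G => ℂ) 1 ≃ₗᵢ[ℂ] LG, ∀ x, HasSum (fun g => x g • δG g) (Ψ x) := by
  obtain ⟨-, hn, -, hd⟩ := hLG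
  have h1 : ∀ g, ‖δG g‖ = 1 := by
    intro g
    have := hn {g} (fun _ => 1)
    simpa using this
  have hs : ∀ x : lp (fun _ : G => ℂ) 1, Summable fun g => x g • δG g := by
    intro x
    refine Summable.of_norm ?_
    simpa [norm_smul, h1] using l1_summable x
  let T : lp (fun _ : G => ℂ) 1 →ₗᵢ[ℂ] LG :=
    { toFun := fun x => ∑' g, x g • δG g
      map_add' := by
        intro x y
        simp only [lp.coeFn_add, Pi.add_apply, add_smul]
        exact (hs x).tsum_add (hs y)
      map_smul' := by
        intro c x
        simp only [lp.coeFn_smul, Pi.smul_apply, RingHom.id_apply, smul_assoc]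
        exact (hs x).tsum_const_smul c
      norm_map' := by
        intro x
        rw [l1_norm]
        refine tendsto_nhds_unique ((hs x).hasSum.norm) ?_
        have := (l1_summable x).hasSum
        unfold HasSum at this
        simpa [hn] using this }
  have hsurj : Function.Surjective T := by
    have hcl : IsClosed (Set.range T) := T.isometry.isClosedEmbedding.isClosed_range
    have hsub : (Submodule.span ℂ (Set.range δG) : Set LG) ⊆ Set.range T := by
      have : Submodule.span ℂ (Set.range δG) ≤ LinearMap.range T.toLinearMap := by
        rw [Submodule.span_le]
        rintro _ ⟨g, rfl⟩
        classical
        refine ⟨lp.single 1 g (1 : ℂ), ?_⟩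
        change ∑' k, (lp.single 1 g (1 : ℂ) : lp (fun _ : G => ℂ) 1) k • δG k = δG g
        rw [tsum_eq_single g]
        · simp
        · intro k hk
          simp [lp.single_apply, hk]
      exact this
    intro y
    have hy : y ∈ closure (Submodule.span ℂ (Set.range δG) : Set LG) := hd y
    exact (closure_minimal hsub hcl) hy
  refine ⟨LinearIsometryEquiv.ofSurjective T hsurj, fun x => ?_⟩
  exact (hs x).hasSum

theorem l1_mul_left [Group G] {LG : Type*} [NormedRing LG] [NormedAlgebra ℂ LG]
    [CompleteSpace LG] (δG : G → LG) (hLG : IsL1SemigroupAlgebra G LG δG)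
    (Ψ : lp (fun _ : G => ℂ) 1 ≃ₗᵢ[ℂ] LG) (hΨ : ∀ x, HasSum (fun g => x g • δG g) (Ψ x))
    (h : G) (y : LG) (g : G) : Ψ.symm (δG h * y) g = Ψ.symm y (h⁻¹ * g) := by
  obtain ⟨x, rfl⟩ := Ψ.surjective y
  have hs : Summable fun g => ‖x (h⁻¹ * g)‖ :=
    ((Equiv.mulLeft h⁻¹).summable_iff (f := fun g => ‖x g‖)).2 (l1_summable x)
  have e : δG h * Ψ x = Ψ (l1mk (fun g => x (h⁻¹ * g)) hs) := by
    have a1 := (hΨ x).mul_left (δG h)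
    have a2 := hΨ (l1mk (fun g => x (h⁻¹ * g)) hs)
    rw [← (Equiv.mulLeft h).hasSum_iff] at a2
    refine a1.unique ?_
    have ef : (fun k => δG h * (x k • δG k)) =
        (fun g => l1mk (fun g => x (h⁻¹ * g)) hs g • δG g) ∘ (Equiv.mulLeft h) := by
      funext k
      simp [l1mk_apply, hLG.1]
    rw [ef]
    exact a2
  rw [e, Ψ.symm_apply_apply, Ψ.symm_apply_apply, l1mk_apply]

theorem l1_mul_right [Group G] {LG : Type*} [NormedRing LG] [NormedAlgebra ℂ LG]
    [CompleteSpace LG] (δG : G → LG) (hLG : IsL1SemigroupAlgebra G LG δG)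
    (Ψ : lp (fun _ : G => ℂ) 1 ≃ₗᵢ[ℂ] LG) (hΨ : ∀ x, HasSum (fun g => x g • δG g) (Ψ x))
    (h : G) (y : LG) (g : G) : Ψ.symm (y * δG h) g = Ψ.symm y (g * h⁻¹) := by
  obtain ⟨x, rfl⟩ := Ψ.surjective y
  have hs : Summable fun g => ‖x (g * h⁻¹)‖ :=
    ((Equiv.mulRight h⁻¹).summable_iff (f := fun g => ‖x g‖)).2 (l1_summable x)
  have e : Ψ x * δG h = Ψ (l1mk (fun g => x (g * h⁻¹)) hs) := by
    have a1 := (hΨ x).mul_right (δG h)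
    have a2 := hΨ (l1mk (fun g => x (g * h⁻¹)) hs)
    rw [← (Equiv.mulRight h).hasSum_iff] at a2
    refine a1.unique ?_
    have ef : (fun k => x k • δG k * δG h) =
        (fun g => l1mk (fun g => x (g * h⁻¹)) hs g • δG g) ∘ (Equiv.mulRight h) := by
      funext k
      simp [l1mk_apply, hLG.1]
    rw [ef]
    exact a2
  rw [e, Ψ.symm_apply_apply, Ψ.symm_apply_apply, l1mk_apply]

end base_case

section inverse_semigroup

variable {S : Type*} [Semigroup S] {star : S → S}

theorem IsInverseSemigroup.star_idem (hS : IsInverseSemigroup S star) {e : S} (he : e * e = e) :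
    star e = e := (hS.2.2 e e (by rw [he, he]) (by rw [he, he])).symm

theorem IsInverseSemigroup.mul_idem (hS : IsInverseSemigroup S star) {e f : S} (he : e * e = e)
    (hf : f * f = f) : e * f * (e * f) = e * f := by
  obtain ⟨h1, h2, h3⟩ := hS
  obtain ⟨x, hx⟩ : ∃ x, x = star (e * f) := ⟨_, rfl⟩
  have a1 : e * f * x * (e * f) = e * f := by rw [hx]; exact h1 _
  have a2 : x * (e * f) * x = x := by rw [hx]; exact h2 _
  have a3 : f * x * e = x := by
    refine (h3 (e * f) (f * x * e) ?_ ?_).trans hx.symm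
    · calc e * f * (f * x * e) * (e * f) = e * (f * f) * x * (e * e) * f := by
            simp only [mul_assoc]
        _ = e * f * x * (e * f) := by rw [he, hf]; simp only [mul_assoc]
        _ = _ := a1
    · calc f * x * e * (e * f) * (f * x * e) = f * (x * ((e * e) * (f * f)) * x) * e := by
            simp only [mul_assoc]
        _ = f * x * e := by rw [he, hf, a2]
  have a4 : x * x = x := by
    calc x * x = (f * x * e) * (f * x * e) := by rw [a3]
      _ = f * (x * (e * f) * x) * e := by simp only [mul_assoc]
      _ = x := by rw [a2, a3]
  have a5 : e * f = star x := h3 x (e * f) a2 a1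
  have a6 : x = star x := h3 x x (by rw [a4, a4]) (by rw [a4, a4])
  rw [a5, ← a6, a4]

theorem IsInverseSemigroup.idem_comm (hS : IsInverseSemigroup S star) {e f : S} (he : e * e = e)
    (hf : f * f = f) : e * f = f * e := by
  have b1 := hS.mul_idem he hf
  have b2 := hS.mul_idem hf he
  rw [← hS.star_idem b1]
  refine (hS.2.2 (e * f) (f * e) ?_ ?_).symm
  · calc e * f * (f * e) * (e * f) = e * (f * f) * (e * e) * f := by simp only [mul_assoc]
      _ = e * f * (e * f) := by rw [he, hf]; simp only [mul_assoc]
      _ = _ := b1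
  · calc f * e * (e * f) * (f * e) = f * (e * e) * (f * f) * e := by simp only [mul_assoc]
      _ = f * e * (f * e) := by rw [he, hf]; simp only [mul_assoc]
      _ = _ := b2

theorem IsInverseSemigroup.idem_right (hS : IsInverseSemigroup S star) (s : S) :
    s * star s * (s * star s) = s * star s := by
  rw [← mul_assoc, hS.1]

theorem IsInverseSemigroup.idem_left (hS : IsInverseSemigroup S star) (s : S) :
    star s * s * (star s * s) = star s * s := by
  rw [← mul_assoc, hS.2.1]

theorem IsInverseSemigroup.star_mul (hS : IsInverseSemigroup S star) (s t : S) :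
    star (s * t) = star t * star s := by
  have hc := hS.idem_comm (hS.idem_right t) (hS.idem_left s)
  refine (hS.2.2 (s * t) (star t * star s) ?_ ?_).symm
  · calc s * t * (star t * star s) * (s * t) = s * ((t * star t) * (star s * s)) * t := by
          simp only [mul_assoc]
      _ = (s * star s * s) * (t * star t * t) := by rw [hc]; simp only [mul_assoc]
      _ = s * t := by rw [hS.1, hS.1]
  · calc star t * star s * (s * t) * (star t * star s)
        = star t * ((star s * s) * (t * star t)) * star s := by simp only [mul_assoc]
      _ = (star t * t * star t) * (star s * s * star s) := by rw [← hc]; simp only [mul_assoc]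
      _ = _ := by rw [hS.2.1, hS.2.1]

theorem IsInverseSemigroup.conj_idem (hS : IsInverseSemigroup S star) {e : S} (he : e * e = e)
    (t : S) : (star t * e * t) * (star t * e * t) = star t * e * t ∧
      t * (star t * e * t) = e * t := by
  have hc := hS.idem_comm (hS.idem_right t) he
  have h2 : t * (star t * e * t) = e * t := by
    calc t * (star t * e * t) = (t * star t * e) * t := by simp only [mul_assoc]
      _ = e * (t * star t * t) := by rw [hc]; simp only [mul_assoc]
      _ = e * t := by rw [hS.1]
  refine ⟨?_, h2⟩
  calc (star t * e * t) * (star t * e * t) = star t * e * (t * (star t * e * t)) := by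
        simp only [mul_assoc]
    _ = star t * (e * e) * t := by rw [h2]; simp only [mul_assoc]
    _ = _ := by rw [he]

end inverse_semigroup

section closed_range

theorem l1_opNorm_le {S : Type*} [Semigroup S] {L : Type*} [NonUnitalNormedRing L]
    [NormedSpace ℂ L] [CompleteSpace L] (δ : S → L) (hL : IsL1SemigroupAlgebra S L δ)
    {X : Type*} [NormedAddCommGroup X] [NormedSpace ℂ X] (φ : L →L[ℂ] X) (B : ℝ) (hB : 0 ≤ B)
    (h : ∀ s, ‖φ (δ s)‖ ≤ B) : ‖φ‖ ≤ B := by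
  obtain ⟨Ψ, hΨ⟩ := l1_realize δ hL
  refine φ.opNorm_le_bound hB fun a => ?_
  obtain ⟨x, rfl⟩ := Ψ.surjective a
  have h1 := (hΨ x).mapL φ
  have h2 : HasSum (fun s => B * ‖x s‖) (B * ‖x‖) := by
    rw [l1_norm]
    exact (l1_summable x).hasSum.mul_left B
  rw [Ψ.norm_map, ← h1.tsum_eq]
  refine tsum_of_norm_bounded h2 fun s => ?_
  rw [map_smul, norm_smul, mul_comm]
  exact mul_le_mul_of_nonneg_right (h s) (norm_nonneg _)

theorem closed_image_of_lift {M Y : Type*} [NormedAddCommGroup M] [CompleteSpace M]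
    [NormedAddCommGroup Y] (d : M →+ Y) (B : ℝ) (hb : ∀ x, ‖d x‖ ≤ B * ‖x‖)
    (N : AddSubgroup M) (hN : IsClosed (N : Set M)) (K : ℝ) (hK : 0 ≤ K)
    (h : ∀ x ∈ N, ∃ y ∈ N, d y = d x ∧ ‖y‖ ≤ K * ‖d x‖) :
    IsClosed {T : Y | ∃ x ∈ N, d x = T} := by
  have : CompleteSpace N := hN.completeSpace_coe
  let g : NormedAddGroupHom N Y :=
    (d.comp N.subtype).mkNormedAddGroupHom B (fun x => hb x.1)
  have hg : ∀ x : N, g x = d x.1 := fun x => rfl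
  have hsurj : g.SurjectiveOnWith g.range (K + 1) := by
    intro T hT
    obtain ⟨x, hx⟩ := (NormedAddGroupHom.mem_range _ _).1 hT
    obtain ⟨y, hy, h1, h2⟩ := h x.1 x.2
    rw [← hg, hx] at h1 h2
    refine ⟨⟨y, hy⟩, h1, ?_⟩
    have h3 := norm_nonneg T
    have h4 : ‖(⟨y, hy⟩ : N)‖ = ‖y‖ := rfl
    rw [h4]
    linarith
  have hcl := controlled_closure_of_complete (by linarith : (0 : ℝ) < K + 1) one_pos hsurj
  refine isClosed_of_closure_subset fun T hT => ?_
  have heq : {T : Y | ∃ x ∈ N, d x = T} = (g.range : Set Y) := by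
    ext T
    constructor
    · rintro ⟨x, hx, rfl⟩
      exact (NormedAddGroupHom.mem_range _ _).2 ⟨⟨x, hx⟩, rfl⟩
    · intro hT
      obtain ⟨x, hx⟩ := (NormedAddGroupHom.mem_range _ _).1 hT
      exact ⟨x.1, x.2, hx⟩
  rw [heq] at hT
  obtain ⟨x, hx, -⟩ := hcl T hT
  exact ⟨x.1, x.2, hx⟩

section cobd

variable {L : Type*} [NonUnitalNormedRing L]
    [NormedSpace ℂ L] [IsScalarTower ℂ L L] [SMulCommClass ℂ L L]
    {X : Type*} [NormedAddCommGroup X] [NormedSpace ℂ X]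

/-- The coboundary of a 1-cochain. -/
def cobd (l : L →L[ℂ] X →L[ℂ] X) (r : X →L[ℂ] L →L[ℂ] X) (φ : L →L[ℂ] X) :
    L →L[ℂ] L →L[ℂ] X :=
  ((ContinuousLinearMap.compL ℂ L X X).flip φ).comp l
      - (ContinuousLinearMap.compL ℂ L L X φ).comp (ContinuousLinearMap.mul ℂ L) + r.comp φ

theorem cobd_apply (l : L →L[ℂ] X →L[ℂ] X) (r : X →L[ℂ] L →L[ℂ] X) (φ : L →L[ℂ] X) (a b : L) :
    cobd l r φ a b = l a (φ b) - φ (a * b) + r (φ a) b := rfl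

theorem cobd_add (l : L →L[ℂ] X →L[ℂ] X) (r : X →L[ℂ] L →L[ℂ] X) (φ φ' : L →L[ℂ] X) :
    cobd l r (φ + φ') = cobd l r φ + cobd l r φ' := by
  ext a b
  simp only [cobd_apply, add_apply, map_add]
  abel

theorem cobd_norm (l : L →L[ℂ] X →L[ℂ] X) (r : X →L[ℂ] L →L[ℂ] X) (φ : L →L[ℂ] X) :
    ‖cobd l r φ‖ ≤ (‖l‖ + 1 + ‖r‖) * ‖φ‖ := by
  have p1 : 0 ≤ ‖l‖ := norm_nonneg l
  have p2 : 0 ≤ ‖r‖ := norm_nonneg r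
  have p3 : 0 ≤ ‖φ‖ := norm_nonneg φ
  refine ContinuousLinearMap.opNorm_le_bound₂ _ (mul_nonneg (by linarith) p3) fun a b => ?_
  rw [cobd_apply]
  have p4 : 0 ≤ ‖a‖ := norm_nonneg a
  have p5 : 0 ≤ ‖b‖ := norm_nonneg b
  have b1 : ‖l a (φ b)‖ ≤ ‖l‖ * ‖a‖ * (‖φ‖ * ‖b‖) :=
    (l.le_opNorm₂ a (φ b)).trans (mul_le_mul_of_nonneg_left (φ.le_opNorm b) (mul_nonneg p1 p4))
  have b2 : ‖φ (a * b)‖ ≤ ‖φ‖ * (‖a‖ * ‖b‖) :=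
    (φ.le_opNorm _).trans (mul_le_mul_of_nonneg_left (norm_mul_le a b) p3)
  have b3 : ‖r (φ a) b‖ ≤ ‖r‖ * (‖φ‖ * ‖a‖) * ‖b‖ :=
    (r.le_opNorm₂ (φ a) b).trans
      (mul_le_mul_of_nonneg_right (mul_le_mul_of_nonneg_left (φ.le_opNorm a) p2) p5)
  have b4 := norm_add_le (l a (φ b) - φ (a * b)) (r (φ a) b)
  have b5 := norm_sub_le (l a (φ b)) (φ (a * b))
  generalize ‖l‖ = x1 at *
  generalize ‖r‖ = x2 at *
  generalize ‖φ‖ = x3 at *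
  generalize ‖a‖ = x4 at *
  generalize ‖b‖ = x5 at *
  calc _ ≤ x1 * x4 * (x3 * x5) + x3 * (x4 * x5) + x2 * (x3 * x4) * x5 := by
        linarith
    _ = _ := by ring

/-- The module maps. -/
def modMaps {LE : Type*} (κ : LE → L) (f : LE → ℂ) (X : Type*) [NormedAddCommGroup X]
    [NormedSpace ℂ X] : AddSubgroup (L →L[ℂ] X) where
  carrier := {φ | ∀ a β, φ (a * κ β) = f β • φ a}
  zero_mem' := by intro a β; simp
  add_mem' := by
    intro x y hx hy a β
    rw [add_apply, add_apply, hx, hy, smul_add]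
  neg_mem' := by
    intro x hx a β
    rw [neg_apply, neg_apply, hx, smul_neg]

theorem mem_modMaps {LE : Type*} (κ : LE → L) (f : LE → ℂ) (φ : L →L[ℂ] X) :
    φ ∈ modMaps κ f X ↔ ∀ a β, φ (a * κ β) = f β • φ a := Iff.rfl

theorem isClosed_modMaps {LE : Type*} (κ : LE → L) (f : LE → ℂ) :
    IsClosed (modMaps κ f X : Set (L →L[ℂ] X)) := by
  have : (modMaps κ f X : Set (L →L[ℂ] X)) =
      ⋂ (a : L) (β : LE), {φ | φ (a * κ β) = f β • φ a} := by
    ext φ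
    simp only [Set.mem_iInter]
    rfl
  rw [this]
  refine isClosed_iInter fun a => isClosed_iInter fun β => ?_
  exact isClosed_eq (by fun_prop) (by fun_prop)

theorem cobd_inner (l : L →L[ℂ] X →L[ℂ] X) (r : X →L[ℂ] L →L[ℂ] X)
    (hl : ∀ a b x, l (a * b) x = l a (l b x)) (hr : ∀ a b x, r x (a * b) = r (r x a) b)
    (hlr : ∀ a b x, l a (r x b) = r (l a x) b) (φ D : L →L[ℂ] X) (u : X)
    (hD : ∀ a, D a = r u a - l a u) : cobd l r (φ - D) = cobd l r φ := by
  ext a b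
  rw [cobd_apply, cobd_apply]
  simp only [sub_apply, hD, map_sub, hl, hr, hlr]
  abel

end cobd

theorem closed_coboundaries {S : Type*} [Semigroup S] {L : Type*} [NonUnitalNormedRing L]
    [NormedSpace ℂ L] [IsScalarTower ℂ L L] [SMulCommClass ℂ L L] [CompleteSpace L]
    (δ : S → L) (hL : IsL1SemigroupAlgebra S L δ)
    {LE : Type*} (κ : LE → L) (f : LE → ℂ)
    {X : Type*} [NormedAddCommGroup X] [NormedSpace ℂ X] [CompleteSpace X]
    (l : L →L[ℂ] X →L[ℂ] X) (r : X →L[ℂ] L →L[ℂ] X)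
    (hl : ∀ a b x, l (a * b) x = l a (l b x)) (hr : ∀ a b x, r x (a * b) = r (r x a) b)
    (hlr : ∀ a b x, l a (r x b) = r (l a x) b)
    (hlf : ∀ a β x, l (a * κ β) x = f β • l a x) (hrf : ∀ a β x, r x (a * κ β) = f β • r x a)
    (K : ℝ) (hK : 0 ≤ K)
    (key : ∀ φ : L →L[ℂ] X, (∀ a β, φ (a * κ β) = f β • φ a) → ∀ ε : ℝ, 0 ≤ ε →
      (∀ a b, ‖l a (φ b) - φ (a * b) + r (φ a) b‖ ≤ ε * ‖a‖ * ‖b‖) →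
      ∃ u : X, ∀ s, ‖r u (δ s) - l (δ s) u - φ (δ s)‖ ≤ K * ε) :
    IsClosed {T : L →L[ℂ] L →L[ℂ] X | ∃ S' : L →L[ℂ] X,
      (∀ a β, S' (a * κ β) = f β • S' a) ∧
        ∀ a b : L, T a b = l a (S' b) - S' (a * b) + r (S' a) b} := by
  have hcl := closed_image_of_lift (AddMonoidHom.mk' (cobd l r) (cobd_add l r)) _
    (fun x => cobd_norm l r x) (modMaps κ f X) (isClosed_modMaps κ f) K hK (by
    intro φ hφ
    have hn : 0 ≤ ‖cobd l r φ‖ := norm_nonneg (cobd l r φ)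
    obtain ⟨u, hu⟩ := key φ hφ ‖cobd l r φ‖ hn
      (fun a b => (cobd l r φ).le_opNorm₂ a b)
    have hD : ∀ a, (r u - l.flip u) a = r u a - l a u := fun a => rfl
    generalize r u - l.flip u = D at hD
    refine ⟨φ - D, ?_, cobd_inner l r hl hr hlr φ D u hD, ?_⟩
    · refine sub_mem hφ ?_
      rw [mem_modMaps]
      intro a β
      rw [hD, hD, hlf, hrf, smul_sub]
    · refine l1_opNorm_le δ hL _ _ (mul_nonneg hK hn) fun s => ?_
      rw [sub_apply, norm_sub_rev, hD]
      exact hu s)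
  refine Eq.mpr (congrArg IsClosed (Set.ext fun T => ?_)) hcl
  constructor
  · rintro ⟨S', h1, h2⟩
    refine ⟨S', h1, ?_⟩
    ext a b
    exact (h2 a b).symm
  · rintro ⟨φ, h1, rfl⟩
    exact ⟨φ, h1, fun a b => rfl⟩

end closed_range

/-- The sequence of cones in the tower of duals. -/
def coneSeq (W : ℕ → BanachPkg)
    (eD : ∀ m, (W (m + 1)).carrier ≃ₗᵢ[ℂ] ((W m).carrier →L[ℂ] ℂ))
    (P₀ : AddSubmonoid (W 0).carrier) : ∀ m, AddSubmonoid (W m).carrier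
  | 0 => P₀
  | m + 1 => dualCone (eD m) (coneSeq W eD P₀ m)

theorem coneSeq_good (W : ℕ → BanachPkg)
    (eD : ∀ m, (W (m + 1)).carrier ≃ₗᵢ[ℂ] ((W m).carrier →L[ℂ] ℂ))
    (P₀ : AddSubmonoid (W 0).carrier) (h0 : GoodCone P₀ 1) (m : ℕ) :
    ∃ C, GoodCone (coneSeq W eD P₀ m) C := by
  induction m with
  | zero => exact ⟨1, h0⟩
  | succ m ih =>
    obtain ⟨C, hC⟩ := ih
    exact ⟨_, hC.dual (eD m)⟩

theorem coneSeq_hasUnit (W : ℕ → BanachPkg)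
    (eD : ∀ m, (W (m + 1)).carrier ≃ₗᵢ[ℂ] ((W m).carrier →L[ℂ] ℂ))
    (P₀ : AddSubmonoid (W 0).carrier) (h0 : GoodCone P₀ 1) (hu : HasUnit P₀) (n : ℕ) :
    HasUnit (coneSeq W eD P₀ (2 * n)) := by
  induction n with
  | zero => exact hu
  | succ n ih =>
    obtain ⟨C, hC⟩ := coneSeq_good W eD P₀ h0 (2 * n + 1)
    exact HasUnit.bidual ih (eD (2 * n)) (eD (2 * n + 1)) hC

/-- In the setting of the previous statement (inverse semigroup `S`,
right-multiplication/trivial-left `ℓ¹(E)`-actions, `ℓ¹(S)/J ≅ ℓ¹(G_S)`, tower of iterated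
duals `W m = ℓ¹(G_S)^{(m)}` with the canonical dual bimodule actions), for every
`n ∈ ℕ ∪ {0}` the second module cohomology group
`H²_{ℓ¹(E)}(ℓ¹(S), ℓ¹(G_S)^{(2n+1)})` is a Banach space: the set of module 2-coboundaries
is closed in the space of bounded `ℓ¹(E)`-module 2-cocycles
`ℓ¹(S) × ℓ¹(S) → ℓ¹(G_S)^{(2n+1)}`. -/
theorem stmt_16

    {S : Type*} [Semigroup S] (star : S → S) (hS : IsInverseSemigroup S star)
    -- `L = ℓ¹(S)`
    {L : Type*} [NonUnitalNormedRing L] [NormedSpace ℂ L] [IsScalarTower ℂ L L]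
    [SMulCommClass ℂ L L] [CompleteSpace L]
    (δ : S → L) (hL : IsL1SemigroupAlgebra S L δ)
    -- `LE = ℓ¹(E)`, realized inside `L` via the isometric embedding `κ`
    {LE : Type*} [NonUnitalNormedRing LE] [NormedSpace ℂ LE] [IsScalarTower ℂ LE LE]
    [SMulCommClass ℂ LE LE] [CompleteSpace LE]
    (δE : {e : S // e * e = e} → LE)
    (hδE_norm : ∀ (F : Finset {e : S // e * e = e}) (c : {e : S // e * e = e} → ℂ),
      ‖∑ e ∈ F, c e • δE e‖ = ∑ e ∈ F, ‖c e‖)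
    (hδE_dense : Dense ((Submodule.span ℂ (Set.range δE) : Submodule ℂ LE) : Set LE))
    (κ : LE →L[ℂ] L) (hκ_mul : ∀ x y, κ (x * y) = κ x * κ y) (hκ_iso : ∀ x, ‖κ x‖ = ‖x‖)
    (hκδ : ∀ e, κ (δE e) = δ e.1)
    -- the augmentation character `f` on `ℓ¹(E)`
    (f : LE →L[ℂ] ℂ) (hf_mul : ∀ x y, f (x * y) = f x * f y) (hf_one : ∀ e, f (δE e) = 1)
    -- `J`: the closed ideal of `ℓ¹(S)` generated by the elements `δ_{set} − δ_{st}`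
    (J : Submodule ℂ L)
    (hJ : IsClosedIdealGeneratedBy J
      {x : L | ∃ s t e : S, e * e = e ∧ x = δ (s * e * t) - δ (s * t)})
    -- `G = G_S = S/∼`, the maximal group homomorphic image of `S`
    {G : Type*} [Group G] (π : S → G)
    (hπ_mul : ∀ s t, π (s * t) = π s * π t) (hπ_surj : Function.Surjective π)
    (hπ_rel : ∀ s t, π s = π t ↔ δ s - δ t ∈ J)
    (hπ_univ : ∀ (H : Type) [Group H] (φ : S → H), (∀ s t, φ (s * t) = φ s * φ t) →
      ∃ ψ : G →* H, ∀ s, ψ (π s) = φ s)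
    -- `LG = ℓ¹(G_S)`
    {LG : Type*} [NormedRing LG] [NormedAlgebra ℂ LG] [CompleteSpace LG]
    (δG : G → LG) (hLG : IsL1SemigroupAlgebra G LG δG)
    -- `θ : ℓ¹(S) → ℓ¹(G_S)`: the continuous algebra homomorphism induced by `π`
    (θ : L →L[ℂ] LG) (hθ_mul : ∀ a b, θ (a * b) = θ a * θ b)
    (hθδ : ∀ s, θ (δ s) = δG (π s))
    (hθ_surj : Function.Surjective θ)
    (hθ_ker : ∀ a, θ a = 0 ↔ a ∈ J)
    (hθ_norm : ∀ a, ‖θ a‖ = ⨅ j : J, ‖a + (j : L)‖)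
    -- the tower `W m = ℓ¹(G_S)^{(m)}` of iterated duals of `ℓ¹(G_S)`
    (W : ℕ → BanachPkg)
    (ψ0 : (W 0).carrier ≃ₗᵢ[ℂ] LG)
    (eD : ∀ m, (W (m + 1)).carrier ≃ₗᵢ[ℂ] ((W m).carrier →L[ℂ] ℂ))
    -- the canonical `ℓ¹(S)`-bimodule actions on the tower: on `W 0 = ℓ¹(G_S)` via the
    -- algebra homomorphism `θ`, and on each dual by transposition
    (lW : ∀ m, L →L[ℂ] (W m).carrier →L[ℂ] (W m).carrier)
    (rW : ∀ m, (W m).carrier →L[ℂ] L →L[ℂ] (W m).carrier)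
    (hlW0 : ∀ (a : L) (w : (W 0).carrier), ψ0 (lW 0 a w) = θ a * ψ0 w)
    (hrW0 : ∀ (w : (W 0).carrier) (a : L), ψ0 (rW 0 w a) = ψ0 w * θ a)
    (hlWsucc : ∀ (m : ℕ) (a : L) (φ : (W (m + 1)).carrier) (w : (W m).carrier),
      eD m (lW (m + 1) a φ) w = eD m φ (rW m w a))
    (hrWsucc : ∀ (m : ℕ) (φ : (W (m + 1)).carrier) (a : L) (w : (W m).carrier),
      eD m (rW (m + 1) φ a) w = eD m φ (lW m a w))
    (n : ℕ) :
    -- conclusion: the module 2-coboundaries form a closed subset of the space of bounded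
    -- `ℓ¹(E)`-module 2-cocycles `ℓ¹(S) × ℓ¹(S) → ℓ¹(G_S)^{(2n+1)}`
    IsClosed {T : {T : L →L[ℂ] L →L[ℂ] (W (2 * n + 1)).carrier //
        (∀ (a b : L) (β : LE), T (a * κ β) b = f β • T a b) ∧
        (∀ (a b : L) (β : LE), T a (b * κ β) = f β • T a b) ∧
        ∀ a b c : L, lW (2 * n + 1) a (T b c) - T (a * b) c + T a (b * c) -
          rW (2 * n + 1) (T a b) c = 0} |
      ∃ S' : L →L[ℂ] (W (2 * n + 1)).carrier,
        (∀ (a : L) (β : LE), S' (a * κ β) = f β • S' a) ∧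
        ∀ a b : L, T.1 a b =
          lW (2 * n + 1) a (S' b) - S' (a * b) + rW (2 * n + 1) (S' a) b} := by
  classical
  obtain ⟨Ψ, hΨ⟩ := l1_realize δG hLG
  have hP₀ := baseCone_good (Ψ.trans ψ0.symm)
  have hu₀ := baseCone_hasUnit (Ψ.trans ψ0.symm)
  have hPm := coneSeq_good W eD (baseCone (Ψ.trans ψ0.symm)) hP₀
  have hPu := coneSeq_hasUnit W eD (baseCone (Ψ.trans ψ0.symm)) hP₀ hu₀ n
  -- invariance of the cones
  have hinv : ∀ m s, (∀ p ∈ coneSeq W eD (baseCone (Ψ.trans ψ0.symm)) m,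
      lW m (δ s) p ∈ coneSeq W eD (baseCone (Ψ.trans ψ0.symm)) m) ∧
      (∀ p ∈ coneSeq W eD (baseCone (Ψ.trans ψ0.symm)) m,
      rW m p (δ s) ∈ coneSeq W eD (baseCone (Ψ.trans ψ0.symm)) m) := by
    intro m s
    induction m with
    | zero =>
      constructor
      · intro p hp g
        change 0 ≤ (Ψ.symm (ψ0 (lW 0 (δ s) p)) g).re ∧ (Ψ.symm (ψ0 (lW 0 (δ s) p)) g).im = 0
        rw [hlW0, hθδ, l1_mul_left δG hLG Ψ hΨ]
        exact hp _
      · intro p hp g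
        change 0 ≤ (Ψ.symm (ψ0 (rW 0 p (δ s))) g).re ∧ (Ψ.symm (ψ0 (rW 0 p (δ s))) g).im = 0
        rw [hrW0, hθδ, l1_mul_right δG hLG Ψ hΨ]
        exact hp _
    | succ m ih =>
      constructor
      · intro p hp q hq
        rw [hlWsucc]
        exact hp _ (ih.2 q hq)
      · intro p hp q hq
        rw [hrWsucc]
        exact hp _ (ih.1 q hq)
  -- bimodule laws
  have hmod : ∀ m (a b : L) (w : (W m).carrier), lW m (a * b) w = lW m a (lW m b w) ∧
      rW m w (a * b) = rW m (rW m w a) b ∧ lW m a (rW m w b) = rW m (lW m a w) b := by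
    intro m
    induction m with
    | zero =>
      intro a b w
      refine ⟨?_, ?_, ?_⟩ <;> apply ψ0.injective <;> simp only [hlW0, hrW0, hθ_mul, mul_assoc]
    | succ m ih =>
      intro a b w
      refine ⟨?_, ?_, ?_⟩
      · apply (eD m).injective
        ext v
        rw [hlWsucc, hlWsucc, hlWsucc, (ih a b v).2.1]
      · apply (eD m).injective
        ext v
        rw [hrWsucc, hrWsucc, hrWsucc, (ih a b v).1]
      · apply (eD m).injective
        ext v
        rw [hlWsucc, hrWsucc, hrWsucc, hlWsucc, (ih b a v).2.2]
  have hδ1 : δG 1 = 1 := by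
    have h1 : ∀ y : LG, δG 1 * y = y := by
      intro y
      apply Ψ.symm.injective
      ext g
      rw [l1_mul_left δG hLG Ψ hΨ]
      simp
    have h2 := h1 1
    rwa [mul_one] at h2
  have hθe : ∀ e : S, e * e = e → θ (δ e) = 1 := by
    intro e he
    have : π e = 1 := by
      have := hπ_mul e e
      rw [he] at this
      exact (left_eq_mul.1 this)
    rw [hθδ, this, hδ1]
  have hθκ : ∀ β, θ (κ β) = f β • (1 : LG) := by
    have h1 : θ.comp κ = f.smulRight (1 : LG) := by
      refine ContinuousLinearMap.ext_on hδE_dense ?_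
      rintro _ ⟨e, rfl⟩
      change θ (κ (δE e)) = f (δE e) • (1 : LG)
      rw [hκδ, hθe _ e.2, hf_one, one_smul]
    intro β
    exact DFunLike.congr_fun h1 β
  have hid : ∀ m (e : S), e * e = e → ∀ w : (W m).carrier,
      lW m (δ e) w = w ∧ rW m w (δ e) = w := by
    intro m e he
    induction m with
    | zero =>
      intro w
      constructor <;> apply ψ0.injective <;> simp [hlW0, hrW0, hθe e he]
    | succ m ih =>
      intro w
      constructor
      · apply (eD m).injective
        ext v
        rw [hlWsucc, (ih v).2]
      · apply (eD m).injective
        ext v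
        rw [hrWsucc, (ih v).1]
  have hfm : ∀ m (a : L) (β : LE) (w : (W m).carrier),
      lW m (a * κ β) w = f β • lW m a w ∧ rW m w (a * κ β) = f β • rW m w a := by
    intro m a β
    induction m with
    | zero =>
      intro w
      constructor <;> apply ψ0.injective <;> simp [hlW0, hrW0, hθ_mul, hθκ, mul_assoc]
    | succ m ih =>
      intro w
      constructor
      · apply (eD m).injective
        ext v
        rw [hlWsucc, (ih v).2, map_smul, map_smul, smul_apply, hlWsucc]
      · apply (eD m).injective
        ext v
        rw [hrWsucc, (ih v).1, map_smul, map_smul, smul_apply, hrWsucc]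
  obtain ⟨s₀, -⟩ := hπ_surj 1
  have hδn : ∀ s, ‖δ s‖ = 1 := by
    intro s
    have := hL.2.1 {s} (fun _ => 1)
    simpa using this
  obtain ⟨C, hC⟩ := hPm (2 * n)
  obtain ⟨K, hK, happ⟩ := hC.approx hPu
  have hR : 0 ≤ ‖rW (2 * n + 1)‖ := norm_nonneg (rW (2 * n + 1))
  have hcl := closed_coboundaries δ hL (fun β => κ β) (fun β => f β) (lW (2 * n + 1))
    (rW (2 * n + 1)) (fun a b x => (hmod _ a b x).1) (fun a b x => (hmod _ a b x).2.1)
    (fun a b x => (hmod _ a b x).2.2) (fun a β x => (hfm _ a β x).1)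
    (fun a β x => (hfm _ a β x).2)
    (‖rW (2 * n + 1)‖ * (K * ‖rW (2 * n + 1)‖)) (mul_nonneg hR (mul_nonneg hK hR)) (by
    intro φ hφ ε hε hT
    have hrn : ∀ (x : (W (2 * n + 1)).carrier) s, ‖rW (2 * n + 1) x (δ s)‖ ≤
        ‖rW (2 * n + 1)‖ * ‖x‖ := by
      intro x s
      have := (rW (2 * n + 1)).le_opNorm₂ x (δ s)
      rwa [hδn, mul_one] at this
    have hφe : ∀ s e : S, e * e = e → φ (δ (s * e)) = φ (δ s) := by
      intro s e he
      have := hφ (δ s) (δE ⟨e, he⟩)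
      simp only [hκδ, hf_one, one_smul, hL.1] at this
      exact this
    have hre : ∀ (x : (W (2 * n + 1)).carrier) (e s : S), e * e = e →
        rW (2 * n + 1) x (δ (e * s)) = rW (2 * n + 1) x (δ s) := by
      intro x e s he
      rw [← hL.1, (hmod _ _ _ _).2.1, (hid _ e he _).2]
    have hre' : ∀ (x : (W (2 * n + 1)).carrier) (s e : S), e * e = e →
        rW (2 * n + 1) x (δ (s * e)) = rW (2 * n + 1) x (δ s) := by
      intro x s e he
      rw [← hL.1, (hmod _ _ _ _).2.1, (hid _ e he _).2]
    let φ' : S → (W (2 * n + 1)).carrier := fun t => rW (2 * n + 1) (φ (δ t)) (δ (star t))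
    have hstep : ∀ s t, lW (2 * n + 1) (δ s) (rW (2 * n + 1) (φ' t) (δ (star s)))
        - φ' (s * t) + φ' s = rW (2 * n + 1) (lW (2 * n + 1) (δ s) (φ (δ t)) - φ (δ s * δ t)
          + rW (2 * n + 1) (φ (δ s)) (δ t)) (δ (star (s * t))) := by
      intro s t
      have e1 : rW (2 * n + 1) (rW (2 * n + 1) (φ (δ s)) (δ t)) (δ (star (s * t))) = φ' s := by
        rw [← (hmod _ _ _ _).2.1, hL.1, hS.star_mul, ← mul_assoc, hre _ _ _ (hS.idem_right t)]
      have e2 : lW (2 * n + 1) (δ s) (rW (2 * n + 1) (φ' t) (δ (star s))) =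
          rW (2 * n + 1) (lW (2 * n + 1) (δ s) (φ (δ t))) (δ (star (s * t))) := by
        rw [hS.star_mul, ← hL.1, (hmod _ _ _ _).2.1, ← (hmod _ _ _ _).2.2,
          ← (hmod _ _ _ _).2.2]
      rw [map_add, map_sub, add_apply, sub_apply, e1, e2, hL.1]
    have hstepn : ∀ s t, ‖lW (2 * n + 1) (δ s) (rW (2 * n + 1) (φ' t) (δ (star s)))
        - φ' (s * t) + φ' s‖ ≤ ‖rW (2 * n + 1)‖ * ε := by
      intro s t
      rw [hstep]
      refine (hrn _ _).trans (mul_le_mul_of_nonneg_left ?_ hR)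
      have := hT (δ s) (δ t)
      rwa [hδn, hδn, mul_one, mul_one] at this
    let A : S → (W (2 * n)).carrier →L[ℂ] (W (2 * n)).carrier := fun s =>
      (lW (2 * n) (δ (star s))).comp ((rW (2 * n)).flip (δ s))
    let B : S → (W (2 * n)).carrier →L[ℂ] (W (2 * n)).carrier := fun s =>
      (lW (2 * n) (δ s)).comp ((rW (2 * n)).flip (δ (star s)))
    have hAe : ∀ s v, A s v = lW (2 * n) (δ (star s)) (rW (2 * n) v (δ s)) := fun s v => rfl
    have hBe : ∀ s v, B s v = lW (2 * n) (δ s) (rW (2 * n) v (δ (star s))) := fun s v => rfl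
    have hEA : ∀ (x : (W (2 * n + 1)).carrier) s, (eD (2 * n) x).comp (A s) =
        eD (2 * n) (lW (2 * n + 1) (δ s) (rW (2 * n + 1) x (δ (star s)))) := by
      intro x s
      ext v
      rw [hlWsucc, hrWsucc]
      rfl
    obtain ⟨U, hU⟩ := happ s₀ (fun t => eD (2 * n) (φ' t)) (‖rW (2 * n + 1)‖ * ‖φ‖) (by
        intro t
        rw [(eD (2 * n)).norm_map]
        refine (hrn _ _).trans (mul_le_mul_of_nonneg_left ?_ hR)
        have := φ.le_opNorm (δ t)
        rwa [hδn, mul_one] at this) A B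
      (fun s p hp => (hinv _ _).1 _ ((hinv _ _).2 _ hp))
      (fun s p hp => (hinv _ _).1 _ ((hinv _ _).2 _ hp))
      (by
        intro s p
        rw [hAe, hBe, ← (hmod _ _ _ _).2.2, ← (hmod _ _ _ _).1, ← (hmod _ _ _ _).2.1, hL.1,
          (hid _ _ (hS.idem_left s) _).2, (hid _ _ (hS.idem_left s) _).1])
      (by
        intro s p
        rw [hAe, hBe, ← (hmod _ _ _ _).2.2, ← (hmod _ _ _ _).1, ← (hmod _ _ _ _).2.1, hL.1,
          (hid _ _ (hS.idem_right s) _).2, (hid _ _ (hS.idem_right s) _).1])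
      (fun s t => s * t) (‖rW (2 * n + 1)‖ * ε) (by
        intro s t
        rw [hEA, ← map_sub, ← map_add, (eD (2 * n)).norm_map]
        exact hstepn s t) (by
        intro s t
        refine ⟨star s * t, ?_⟩
        congr 1
        have hc := hS.conj_idem (hS.idem_right s) t
        change rW (2 * n + 1) (φ (δ (s * (star s * t)))) (δ (star (s * (star s * t)))) =
          rW (2 * n + 1) (φ (δ t)) (δ (star t))
        rw [← mul_assoc, hS.star_mul, hS.star_idem (hS.idem_right s),
          hre' _ _ _ (hS.idem_right s), ← hc.2, hφe _ _ hc.1])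
    refine ⟨(eD (2 * n)).symm U, fun s => ?_⟩
    set u := (eD (2 * n)).symm U with hu
    have hUu : U = eD (2 * n) u := by simp [hu]
    have h1 := hU s
    rw [hUu, hEA, ← map_sub, ← map_sub, (eD (2 * n)).norm_map] at h1
    have e1 : rW (2 * n + 1) (u - lW (2 * n + 1) (δ s) (rW (2 * n + 1) u (δ (star s))) - φ' s)
        (δ s) = rW (2 * n + 1) u (δ s) - lW (2 * n + 1) (δ s) u - φ (δ s) := by
      have e2 : rW (2 * n + 1) (φ' s) (δ s) = φ (δ s) := by
        rw [← (hmod _ _ _ _).2.1, hL.1, (hid _ _ (hS.idem_left s) _).2]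
      rw [map_sub, map_sub, sub_apply, sub_apply, e2, ← (hmod _ _ _ _).2.2,
        ← (hmod _ _ _ _).2.1, hL.1, (hid _ _ (hS.idem_left s) _).2]
    rw [← e1]
    refine (hrn _ _).trans ?_
    rw [mul_assoc]
    refine mul_le_mul_of_nonneg_left ?_ hR
    rw [mul_assoc]
    exact h1)
  exact hcl.preimage continuous_subtype_val
end
end

section
/- For an inverse semigroup S with set of idempotents E and the stated right-multiplication/trivial-left action of ℓ¹(E) on ℓ¹(S), the quotient Banach algebra ℓ¹(S)/J is isometrically isomorphic to ℓ¹(G_S), where G_S = S/∼ is the maximal group homomorphic image of S; moreover ℓ¹(S)/J is a commutative Banach ℓ¹(S)-ℓ¹(E)-bimodule, since for every s ∈ S one has δ_s − δ_{s e} ∈ J with e = s*s. -/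
noncomputable section

theorem aux_ext {X : Type*} {A : Type*} [NormedAddCommGroup A] [NormedSpace ℂ A]
    {M : Type*} [NormedAddCommGroup M] [NormedSpace ℂ M] (d : X → A)
    (hd : Dense ((Submodule.span ℂ (Set.range d) : Submodule ℂ A) : Set A))
    (T U : A →L[ℂ] M) (h : ∀ x, T (d x) = U (d x)) : T = U := by
  apply ContinuousLinearMap.ext_on hd
  rintro _ ⟨x, rfl⟩
  exact h x

theorem aux_lift {X : Type*} {A : Type*} [NormedAddCommGroup A] [NormedSpace ℂ A]
    {M : Type*} [NormedAddCommGroup M] [NormedSpace ℂ M] [CompleteSpace M] (d : X → A)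
    (hn : ∀ (F : Finset X) (c : X → ℂ), ‖∑ s ∈ F, c s • d s‖ = ∑ s ∈ F, ‖c s‖)
    (hd : Dense ((Submodule.span ℂ (Set.range d) : Submodule ℂ A) : Set A))
    (m : X → M) (hm : ∀ x, ‖m x‖ ≤ 1) :
    ∃ T : A →L[ℂ] M, (∀ x, T (d x) = m x) ∧ ∀ a, ‖T a‖ ≤ ‖a‖ := by
  have hdr : DenseRange (Finsupp.linearCombination ℂ d) := by
    have : Set.range (Finsupp.linearCombination ℂ d) =
        ((Submodule.span ℂ (Set.range d) : Submodule ℂ A) : Set A) := by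
      rw [← Finsupp.range_linearCombination]; rfl
    unfold DenseRange
    rw [this]
    exact hd
  have hb : ∀ c : X →₀ ℂ, ‖Finsupp.linearCombination ℂ m c‖ ≤
      1 * ‖Finsupp.linearCombination ℂ d c‖ := by
    intro c
    rw [one_mul, Finsupp.linearCombination_apply, Finsupp.linearCombination_apply,
      Finsupp.sum, Finsupp.sum, hn]
    refine (norm_sum_le _ _).trans (Finset.sum_le_sum fun x _ => ?_)
    rw [norm_smul]
    exact mul_le_of_le_one_right (norm_nonneg _) (hm x)
  refine ⟨(Finsupp.linearCombination ℂ m).extendOfNorm (Finsupp.linearCombination ℂ d), ?_, ?_⟩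
  · intro x
    have := LinearMap.extendOfNorm_eq hdr ⟨1, hb⟩ (Finsupp.single x 1)
    simpa using this
  · intro a
    have := LinearMap.norm_extendOfNorm_apply_le hdr 1 hb a
    simpa using this

/-- For an inverse semigroup `S` with set of idempotents `E` and the
right-multiplication/trivial-left action of `ℓ¹(E)` on `ℓ¹(S)`, the quotient Banach algebra
`ℓ¹(S)/J` is isometrically isomorphic to `ℓ¹(G_S)`, where `G_S = S/∼` is the maximal group
homomorphic image of `S`: the induced map `θ : ℓ¹(S) → ℓ¹(G_S)` is a surjective algebra
homomorphism whose kernel is exactly `J` and whose norm is the quotient norm.  Moreover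
`ℓ¹(S)/J` is a commutative Banach `ℓ¹(S)`-`ℓ¹(E)`-bimodule, since for every `s ∈ S` one has
`δ_s − δ_{se} ∈ J` with `e = s*s`. -/
theorem stmt_17

    {S : Type*} [Semigroup S] (star : S → S) (hS : IsInverseSemigroup S star)
    -- `L = ℓ¹(S)`
    {L : Type*} [NonUnitalNormedRing L] [NormedSpace ℂ L] [IsScalarTower ℂ L L]
    [SMulCommClass ℂ L L] [CompleteSpace L]
    (δ : S → L) (hL : IsL1SemigroupAlgebra S L δ)
    -- `LE = ℓ¹(E)`, realized inside `L` via the isometric embedding `κ`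
    {LE : Type*} [NonUnitalNormedRing LE] [NormedSpace ℂ LE] [IsScalarTower ℂ LE LE]
    [SMulCommClass ℂ LE LE] [CompleteSpace LE]
    (δE : {e : S // e * e = e} → LE)
    (hδE_norm : ∀ (F : Finset {e : S // e * e = e}) (c : {e : S // e * e = e} → ℂ),
      ‖∑ e ∈ F, c e • δE e‖ = ∑ e ∈ F, ‖c e‖)
    (hδE_dense : Dense ((Submodule.span ℂ (Set.range δE) : Submodule ℂ LE) : Set LE))
    (κ : LE →L[ℂ] L) (hκ_mul : ∀ x y, κ (x * y) = κ x * κ y) (hκ_iso : ∀ x, ‖κ x‖ = ‖x‖)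
    (hκδ : ∀ e, κ (δE e) = δ e.1)
    -- the augmentation character `f` on `ℓ¹(E)`
    (f : LE →L[ℂ] ℂ) (hf_mul : ∀ x y, f (x * y) = f x * f y) (hf_one : ∀ e, f (δE e) = 1)
    -- `J`: the closed ideal of `ℓ¹(S)` generated by the elements `δ_{set} − δ_{st}`
    (J : Submodule ℂ L)
    (hJ : IsClosedIdealGeneratedBy J
      {x : L | ∃ s t e : S, e * e = e ∧ x = δ (s * e * t) - δ (s * t)})
    -- `G = G_S = S/∼`, the maximal group homomorphic image of `S`
    {G : Type*} [Group G] (π : S → G)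
    (hπ_mul : ∀ s t, π (s * t) = π s * π t) (hπ_surj : Function.Surjective π)
    (hπ_rel : ∀ s t, π s = π t ↔ δ s - δ t ∈ J)
    (hπ_univ : ∀ (H : Type) [Group H] (φ : S → H), (∀ s t, φ (s * t) = φ s * φ t) →
      ∃ ψ : G →* H, ∀ s, ψ (π s) = φ s)
    -- `LG = ℓ¹(G_S)`
    {LG : Type*} [NormedRing LG] [NormedAlgebra ℂ LG] [CompleteSpace LG]
    (δG : G → LG) (hLG : IsL1SemigroupAlgebra G LG δG)
    -- `θ : ℓ¹(S) → ℓ¹(G_S)`: the continuous algebra homomorphism induced by `π`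
    (θ : L →L[ℂ] LG) (hθ_mul : ∀ a b, θ (a * b) = θ a * θ b)
    (hθδ : ∀ s, θ (δ s) = δG (π s)) :
    -- conclusion: `θ` identifies `ℓ¹(S)/J` with `ℓ¹(G_S)` isometrically and
    -- isomorphically as Banach algebras …
    Function.Surjective θ ∧
    (∀ a, θ a = 0 ↔ a ∈ J) ∧
    (∀ a, ‖θ a‖ = ⨅ j : J, ‖a + (j : L)‖) ∧
    -- … for every `s ∈ S`, `δ_s − δ_{s e} ∈ J` with `e = s*s` …
    (∀ s : S, δ s - δ (s * (star s * s)) ∈ J) ∧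
    -- … and `ℓ¹(S)/J` is a *commutative* Banach `ℓ¹(S)`-`ℓ¹(E)`-bimodule: the right
    -- `ℓ¹(E)`-action on the quotient coincides with the trivial left action via `f`
    (∀ (a : L) (β : LE), θ (a * κ β) = f β • θ a) := by
  obtain ⟨hS1, -, -⟩ := hS
  obtain ⟨hLm, hLn, -, hLd⟩ := hL
  obtain ⟨hGm, hGn, -, hGd⟩ := hLG
  obtain ⟨⟨hJc, hJl, hJr⟩, hJs, hJmin⟩ := hJ
  have hδ1 : ∀ s, ‖δ s‖ ≤ 1 := fun s => by simpa using (hLn {s} 1).le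
  have hδG1 : ∀ s, ‖δG s‖ ≤ 1 := fun s => by simpa using (hGn {s} 1).le
  have hidem : ∀ e : S, e * e = e → π e = 1 := by
    intro e he
    have := hπ_mul e e
    rw [he] at this
    exact left_eq_mul.mp this
  -- `θ` is contractive
  have hθc : ∀ a, ‖θ a‖ ≤ ‖a‖ := by
    obtain ⟨T, hT, hTn⟩ := aux_lift δ hLn hLd (fun s => δG (π s)) (fun s => hδG1 _)
    have : θ = T := aux_ext δ hLd _ _ fun s => by rw [hθδ, hT]
    rw [this]
    exact hTn
  -- the section
  obtain ⟨ψ, hψ, hψn⟩ := aux_lift δG hGn hGd (fun g => δ (Function.surjInv hπ_surj g))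
    (fun g => hδ1 _)
  have hθψ : ∀ x, θ (ψ x) = x := by
    have : θ.comp ψ = ContinuousLinearMap.id ℂ LG := aux_ext δG hGd _ _ fun g => by
      simp [hψ, hθδ, Function.surjInv_eq hπ_surj]
    intro x
    exact DFunLike.congr_fun this x
  have hψθ : ∀ a, ψ (θ a) - a ∈ J := by
    intro a
    have hcl : IsClosed {a : L | ψ (θ a) - a ∈ J} :=
      hJc.preimage (f := fun a => ψ (θ a) - a) (by fun_prop)
    have hsub : ((Submodule.span ℂ (Set.range δ) : Submodule ℂ L) : Set L) ⊆
        {a : L | ψ (θ a) - a ∈ J} := by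
      have : Submodule.span ℂ (Set.range δ) ≤
          J.comap ((ψ.comp θ - ContinuousLinearMap.id ℂ L : L →L[ℂ] L) : L →ₗ[ℂ] L) := by
        rw [Submodule.span_le]
        rintro _ ⟨s, rfl⟩
        have : δ (Function.surjInv hπ_surj (π s)) - δ s ∈ J :=
          (hπ_rel _ _).1 (Function.surjInv_eq hπ_surj _)
        simpa [hθδ, hψ] using this
      intro x hx
      simpa using this hx
    exact closure_minimal hsub hcl (hLd a)
  have hJker : ∀ a ∈ J, θ a = 0 := by
    have : J ≤ LinearMap.ker (θ : L →ₗ[ℂ] LG) := by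
      apply hJmin
      · refine ⟨?_, ?_, ?_⟩
        · exact isClosed_singleton.preimage θ.continuous
        · intro a x hx
          have hx : θ x = 0 := hx
          change θ (a * x) = 0
          rw [hθ_mul, hx, mul_zero]
        · intro x a hx
          have hx : θ x = 0 := hx
          change θ (x * a) = 0
          rw [hθ_mul, hx, zero_mul]
      · rintro _ ⟨s, t, e, he, rfl⟩
        change θ _ = 0
        rw [map_sub, hθδ, hθδ, hπ_mul, hπ_mul, hπ_mul, hidem e he, mul_one, sub_self]
    intro a ha
    exact this ha
  have hone : ∀ x : LG, x * δG 1 = x := by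
    have : (ContinuousLinearMap.mul ℂ LG).flip (δG 1) = ContinuousLinearMap.id ℂ LG :=
      aux_ext δG hGd _ _ fun g => by simp [hGm]
    intro x
    exact DFunLike.congr_fun this x
  have hθκ : ∀ β, θ (κ β) = f β • δG 1 := by
    have : θ.comp κ = f.smulRight (δG 1) := aux_ext δE hδE_dense _ _ fun e => by
      simp [hκδ, hθδ, hf_one, hidem e.1 e.2]
    intro x
    exact DFunLike.congr_fun this x
  refine ⟨fun x => ⟨ψ x, hθψ x⟩, fun a => ⟨fun h => ?_, hJker a⟩, fun a => ?_, fun s => ?_,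
    fun a β => ?_⟩
  · have := hψθ a
    rw [h, map_zero, zero_sub] at this
    simpa using this
  · apply le_antisymm
    · refine le_ciInf fun j => ?_
      have : θ a = θ (a + j) := by rw [map_add, hJker j j.2, add_zero]
      rw [this]
      exact hθc _
    · refine (ciInf_le ⟨0, ?_⟩ (⟨ψ (θ a) - a, hψθ a⟩ : J)).trans ?_
      · rintro _ ⟨j, rfl⟩
        exact norm_nonneg _
      · simpa using hψn (θ a)
  · rw [← mul_assoc, hS1, sub_self]
    exact J.zero_mem
  · rw [hθ_mul, hθκ, mul_smul_comm, hone]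
end
end
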